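/- arXiv:2407.20396 — 2 statements merged into one kernel-verified Lean document; each statement's English description precedes it below -/
import Mathlib

section
/- Let ρ be a normalized state on registers S, R, E, let M: RE → S'R'E' be a quantum channel, and let Ẽ be a register of large enough dimension to purify RE. Then for any α ∈ (1,2), with α̂ = 1/(2−α): (i) H_α↑(SS'|E')_{M(ρ)} ≥ H_α↑(S|RE)_ρ + inf over normalized states ω on R, E, Ẽ of H_α̂(S'|E'Ẽ)_{Tr_{R'}∘M(ω)}. (ii) If moreover there exists a channel 𝓡: E → E' such that Tr_{S'R'}∘M = 𝓡∘Tr_R (i.e., M is non-signalling from R to E'), then H_α↑(SS'|E')_{M(ρ)} ≥ H_α↑(S|E)_ρ + inf over normalized states ω on R, E, Ẽ of H_α̂(S'|E'Ẽ)_{Tr_{R'}∘M(ω)}. -/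
open scoped Kronecker
open Matrix
open scoped ComplexOrder

noncomputable section
namespace QITLeak

variable {A B : Type*}

/-- Real matrix power via spectral decomposition (Moore–Penrose pseudoinverse powers,
since `(0:ℝ) ^ (p:ℝ) = 0` for `p ≠ 0`). Junk value `0` on non-Hermitian input. -/
noncomputable def mpow [Fintype A] [DecidableEq A] (ρ : Matrix A A ℂ) (p : ℝ) :
    Matrix A A ℂ :=
  if hρ : ρ.IsHermitian then
    (hρ.eigenvectorUnitary : Matrix A A ℂ) *
      Matrix.diagonal (fun i => ((hρ.eigenvalues i ^ p : ℝ) : ℂ)) *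
      (star (hρ.eigenvectorUnitary : Matrix A A ℂ))
  else 0

/-- A normalized state (density matrix). -/
def IsState [Fintype A] (ρ : Matrix A A ℂ) : Prop := ρ.PosSemidef ∧ ρ.trace = 1

/-- A subnormalized state. -/
def IsSubState [Fintype A] (ρ : Matrix A A ℂ) : Prop := ρ.PosSemidef ∧ (ρ.trace).re ≤ 1

/-- Partial trace over the second tensor factor. -/
def ptB [Fintype B] (ρ : Matrix (A × B) (A × B) ℂ) : Matrix A A ℂ :=
  Matrix.of fun a a' => ∑ b, ρ (a, b) (a', b)

/-- Partial trace over the first tensor factor. -/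
def ptA [Fintype A] (ρ : Matrix (A × B) (A × B) ℂ) : Matrix B B ℂ :=
  Matrix.of fun b b' => ∑ a, ρ (a, b) (a, b')

/-- Partial trace over the factor `B`, along a decomposition `X ≃ A × B` of the registers. -/
def traceOut {X A B : Type*} [Fintype B] (e : X ≃ A × B) (ρ : Matrix X X ℂ) :
    Matrix A A ℂ :=
  Matrix.of fun a a' => ∑ b, ρ (e.symm (a, b)) (e.symm (a', b))

/-- Support inclusion `supp ρ ⊆ supp σ` (for PSD matrices: kernel inclusion). -/
def suppSubset [Fintype A] (ρ σ : Matrix A A ℂ) : Prop :=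
  ∀ v : A → ℂ, σ *ᵥ v = 0 → ρ *ᵥ v = 0

/-- The real-valued core formula of the sandwiched Rényi divergence (base 2). -/
def DR (α : ℝ) [Fintype A] [DecidableEq A] (ρ σ : Matrix A A ℂ) : ℝ :=
  (α - 1)⁻¹ * Real.logb 2
    (((mpow (mpow σ ((1 - α) / (2 * α)) * ρ * mpow σ ((1 - α) / (2 * α))) α).trace.re)
      / (ρ.trace).re)

open scoped Classical in
/-- The sandwiched Rényi divergence `D_α(ρ‖σ)`, with value `⊤` outside the
support/orthogonality conditions. -/
def D (α : ℝ) [Fintype A] [DecidableEq A] (ρ σ : Matrix A A ℂ) : EReal :=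
  if (α < 1 ∧ ¬ (ρ * σ = 0 ∧ σ * ρ = 0)) ∨ suppSubset ρ σ then ((DR α ρ σ : ℝ) : EReal)
  else ⊤

/-- The max-divergence `D_∞(ρ‖σ)`: log of the least `μ ≥ 0` with `ρ ≤ μσ` (`⊤` if none). -/
def Dmax [Fintype A] (ρ σ : Matrix A A ℂ) : EReal :=
  sInf {x : EReal | ∃ μ : ℝ, 0 ≤ μ ∧ (μ • σ - ρ).PosSemidef ∧ x = ((Real.logb 2 μ : ℝ) : EReal)}

section Ent
variable [Fintype A] [DecidableEq A] [Fintype B] [DecidableEq B]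

/-- `H_α↑(A|B)_ρ` for `ρ` on `A × B`. -/
def HUp (α : ℝ) (ρ : Matrix (A × B) (A × B) ℂ) : EReal :=
  - sInf {x : EReal | ∃ σ : Matrix B B ℂ, IsState σ ∧ x = D α ρ ((1 : Matrix A A ℂ) ⊗ₖ σ)}

/-- `H_α(A|B)_ρ` for `ρ` on `A × B`. -/
def Hdn (α : ℝ) (ρ : Matrix (A × B) (A × B) ℂ) : EReal :=
  - D α ρ ((1 : Matrix A A ℂ) ⊗ₖ ptA ρ)

/-- `I_α↓(A;B)_ρ` for `ρ` on `A × B`. -/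
def Idown (α : ℝ) (ρ : Matrix (A × B) (A × B) ℂ) : EReal :=
  sInf {x : EReal | ∃ σ : Matrix B B ℂ, IsState σ ∧ x = D α ρ ((ptB ρ) ⊗ₖ σ)}

/-- `I_α(A:B)_ρ` for `ρ` on `A × B`. -/
def Imut (α : ℝ) (ρ : Matrix (A × B) (A × B) ℂ) : EReal :=
  D α ρ ((ptB ρ) ⊗ₖ (ptA ρ))

/-- `I_α↓↓(A:B)_ρ` for `ρ` on `A × B`. -/
def Idd (α : ℝ) (ρ : Matrix (A × B) (A × B) ℂ) : EReal :=
  sInf {x : EReal | ∃ (ω : Matrix A A ℂ) (σ : Matrix B B ℂ),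
    IsState ω ∧ IsState σ ∧ x = D α ρ (ω ⊗ₖ σ)}

/-- `H_min↑(A|B)_ρ = H_∞↑(A|B)_ρ`. -/
def HminUp (ρ : Matrix (A × B) (A × B) ℂ) : EReal :=
  - sInf {x : EReal | ∃ σ : Matrix B B ℂ, IsState σ ∧ x = Dmax ρ ((1 : Matrix A A ℂ) ⊗ₖ σ)}

/-- `I_∞↓(A;B)_ρ`. -/
def ImaxD (ρ : Matrix (A × B) (A × B) ℂ) : EReal :=
  sInf {x : EReal | ∃ σ : Matrix B B ℂ, IsState σ ∧ x = Dmax ρ ((ptB ρ) ⊗ₖ σ)}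

/-- `I_∞(A:B)_ρ` (unoptimized max-information). -/
def ImaxND (ρ : Matrix (A × B) (A × B) ℂ) : EReal :=
  Dmax ρ ((ptB ρ) ⊗ₖ (ptA ρ))

/-- `I_∞↓↓(A:B)_ρ`. -/
def IddMax (ρ : Matrix (A × B) (A × B) ℂ) : EReal :=
  sInf {x : EReal | ∃ (ω : Matrix A A ℂ) (σ : Matrix B B ℂ),
    IsState ω ∧ IsState σ ∧ x = Dmax ρ (ω ⊗ₖ σ)}

end Ent

/-- Trace norm. -/
def traceNorm [Fintype A] [DecidableEq A] (M : Matrix A A ℂ) : ℝ :=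
  (mpow (Mᴴ * M) (1 / 2 : ℝ)).trace.re

/-- Generalized fidelity of subnormalized states. -/
def gFid [Fintype A] [DecidableEq A] (ρ σ : Matrix A A ℂ) : ℝ :=
  traceNorm (mpow ρ (1 / 2 : ℝ) * mpow σ (1 / 2 : ℝ)) +
    Real.sqrt ((1 - ρ.trace.re) * (1 - σ.trace.re))

/-- Purified distance. -/
def pDist [Fintype A] [DecidableEq A] (ρ σ : Matrix A A ℂ) : ℝ :=
  Real.sqrt (1 - gFid ρ σ ^ 2)

section Smooth
variable [Fintype A] [DecidableEq A] [Fintype B] [DecidableEq B]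

/-- Smoothed min-entropy `H_min↑,ε(A|B)_ρ`. -/
def HminUpEps (ε : ℝ) (ρ : Matrix (A × B) (A × B) ℂ) : EReal :=
  sSup {x : EReal | ∃ ρ' : Matrix (A × B) (A × B) ℂ,
    IsSubState ρ' ∧ pDist ρ' ρ ≤ ε ∧ x = HminUp ρ'}

/-- Smoothed max-information `I_max↓,ε(A;B)_ρ`. -/
def ImaxDEps (ε : ℝ) (ρ : Matrix (A × B) (A × B) ℂ) : EReal :=
  sInf {x : EReal | ∃ ρ' : Matrix (A × B) (A × B) ℂ,
    IsSubState ρ' ∧ pDist ρ' ρ ≤ ε ∧ x = ImaxD ρ'}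

/-- Smoothed (unoptimized) max-information `I_max^ε(A:B)_ρ`. -/
def ImaxNDEps (ε : ℝ) (ρ : Matrix (A × B) (A × B) ℂ) : EReal :=
  sInf {x : EReal | ∃ ρ' : Matrix (A × B) (A × B) ℂ,
    IsSubState ρ' ∧ pDist ρ' ρ ≤ ε ∧ x = ImaxND ρ'}

/-- Smoothed max-information `I_max↓↓,ε(A:B)_ρ`. -/
def IddMaxEps (ε : ℝ) (ρ : Matrix (A × B) (A × B) ℂ) : EReal :=
  sInf {x : EReal | ∃ ρ' : Matrix (A × B) (A × B) ℂ,
    IsSubState ρ' ∧ pDist ρ' ρ ≤ ε ∧ x = IddMax ρ'}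

/-- Smoothed Rényi conditional entropy `H_α↑,ε(A|B)_ρ`. -/
def HUpEps (α ε : ℝ) (ρ : Matrix (A × B) (A × B) ℂ) : EReal :=
  sSup {x : EReal | ∃ ρ' : Matrix (A × B) (A × B) ℂ,
    IsSubState ρ' ∧ pDist ρ' ρ ≤ ε ∧ x = HUp α ρ'}

end Smooth

/-- Extension `id_R ⊗ Φ` of a linear map on matrices, with a spectator register on the left. -/
def lext {R A B : Type*} (Φ : Matrix A A ℂ →ₗ[ℂ] Matrix B B ℂ) :
    Matrix (R × A) (R × A) ℂ →ₗ[ℂ] Matrix (R × B) (R × B) ℂ where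
  toFun ρ := Matrix.of fun p q => Φ (Matrix.of fun a a' => ρ (p.1, a) (q.1, a')) p.2 q.2
  map_add' x y := by
    ext p q
    show Φ ((Matrix.of fun a a' => x (p.1, a) (q.1, a'))
        + (Matrix.of fun a a' => y (p.1, a) (q.1, a'))) p.2 q.2 = _
    rw [map_add]; rfl
  map_smul' c x := by
    ext p q
    show Φ (c • (Matrix.of fun a a' => x (p.1, a) (q.1, a'))) p.2 q.2 = _
    rw [_root_.map_smul]; rfl

/-- Extension `Φ ⊗ id_R` of a linear map on matrices, with a spectator register on the right. -/
def rext {A B R : Type*} (Φ : Matrix A A ℂ →ₗ[ℂ] Matrix B B ℂ) :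
    Matrix (A × R) (A × R) ℂ →ₗ[ℂ] Matrix (B × R) (B × R) ℂ where
  toFun ρ := Matrix.of fun p q => Φ (Matrix.of fun a a' => ρ (a, p.2) (a', q.2)) p.1 q.1
  map_add' x y := by
    ext p q
    show Φ ((Matrix.of fun a a' => x (a, p.2) (a', q.2))
        + (Matrix.of fun a a' => y (a, p.2) (a', q.2))) p.1 q.1 = _
    rw [map_add]; rfl
  map_smul' c x := by
    ext p q
    show Φ (c • (Matrix.of fun a a' => x (a, p.2) (a', q.2))) p.1 q.1 = _
    rw [_root_.map_smul]; rfl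

/-- Completely positive trace-preserving map (quantum channel). -/
structure IsCPTP {A B : Type*} [Fintype A] [Fintype B]
    (Φ : Matrix A A ℂ →ₗ[ℂ] Matrix B B ℂ) : Prop where
  cp : ∀ (n : ℕ) (ρ : Matrix (Fin n × A) (Fin n × A) ℂ), ρ.PosSemidef →
    ((lext Φ) ρ).PosSemidef
  tp : ∀ ρ : Matrix A A ℂ, (Φ ρ).trace = ρ.trace

/-- The rank-one (pure) state associated to a vector. -/
def pureState {A : Type*} (ψ : A → ℂ) : Matrix A A ℂ := Matrix.vecMulVec ψ (star ψ)


/-! ## Statement 11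
GEAT-type chain rule: `H_α↑(SS'|E')_{M(ρ)} ≥ H_α↑(S|RE)_ρ + inf_ω H_α̂(S'|E'Ẽ)_{Tr_{R'}∘M(ω)}`,
with the strengthening `H_α↑(S|RE)_ρ → H_α↑(S|E)_ρ` under the non-signalling condition.
Here the purifying register `Ẽ` for `R × E` is taken to be (a copy of) `R × E`. -/

/-- `S × (S' × (R' × E')) ≃ ((S × S') × E') × R'` (group `SS'`, condition on `E'`, trace `R'`). -/
def e1 (S S' R' E' : Type*) : S × (S' × (R' × E')) ≃ ((S × S') × E') × R' where
  toFun x := (((x.1, x.2.1), x.2.2.2), x.2.2.1)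
  invFun y := (y.1.1.1, (y.1.1.2, (y.2, y.1.2)))
  left_inv _ := rfl
  right_inv _ := rfl

/-- `Ẽ × (S' × (R' × E')) ≃ (S' × (E' × Ẽ)) × R'`. -/
def e2 (T S' R' E' : Type*) : T × (S' × (R' × E')) ≃ (S' × (E' × T)) × R' where
  toFun x := ((x.2.1, (x.2.2.2, x.1)), x.2.2.1)
  invFun y := (y.1.2.2, (y.1.1, (y.2, y.1.2.1)))
  left_inv _ := rfl
  right_inv _ := rfl

/-- `S' × (R' × E') ≃ E' × (S' × R')` (marginal on `E'`). -/
def e3 (S' R' E' : Type*) : S' × (R' × E') ≃ E' × (S' × R') where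
  toFun x := (x.2.2, (x.1, x.2.1))
  invFun y := (y.2.1, (y.2.2, y.1))
  left_inv _ := rfl
  right_inv _ := rfl

/-- `S × (R × E) ≃ (S × E) × R` (trace out `R`). -/
def e4 (S R E : Type*) : S × (R × E) ≃ (S × E) × R where
  toFun x := ((x.1, x.2.2), x.2.1)
  invFun y := (y.1.1, (y.2, y.1.2))
  left_inv _ := rfl
  right_inv _ := rfl

set_option linter.unusedSectionVars false

section SpectralCalculus
variable {m n : Type*} [Fintype m] [DecidableEq m] [Fintype n] [DecidableEq n]

/-- Functional calculus of a Hermitian matrix for an arbitrary complex-valued function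
(junk value `0` on non-Hermitian input). -/
def spec (A : Matrix m m ℂ) (f : ℝ → ℂ) : Matrix m m ℂ :=
  if h : A.IsHermitian then
    (h.eigenvectorUnitary : Matrix m m ℂ) * Matrix.diagonal (fun i => f (h.eigenvalues i)) *
      star (h.eigenvectorUnitary : Matrix m m ℂ)
  else 0

lemma mpow_eq_spec (A : Matrix m m ℂ) (p : ℝ) :
    mpow A p = spec A (fun x => ((x ^ p : ℝ) : ℂ)) := rfl

lemma spec_eq {A : Matrix m m ℂ} (h : A.IsHermitian) (f : ℝ → ℂ) :
    spec A f = (h.eigenvectorUnitary : Matrix m m ℂ) *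
      Matrix.diagonal (fun i => f (h.eigenvalues i)) *
      star (h.eigenvectorUnitary : Matrix m m ℂ) := dif_pos h

lemma eig_star_mul {A : Matrix m m ℂ} (h : A.IsHermitian) :
    star (h.eigenvectorUnitary : Matrix m m ℂ) * (h.eigenvectorUnitary : Matrix m m ℂ) = 1 :=
  Unitary.coe_star_mul_self _

lemma eig_mul_star {A : Matrix m m ℂ} (h : A.IsHermitian) :
    (h.eigenvectorUnitary : Matrix m m ℂ) * star (h.eigenvectorUnitary : Matrix m m ℂ) = 1 :=
  Unitary.coe_mul_star_self _

lemma spec_ofReal {A : Matrix m m ℂ} (h : A.IsHermitian) : spec A (fun x => (x : ℂ)) = A := by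
  rw [spec_eq h]
  conv_rhs => rw [h.spectral_theorem]
  rfl

lemma spec_mul_of_diagonal {A : Matrix m m ℂ} (h : A.IsHermitian) {T : Matrix m n ℂ}
    {d : n → ℝ} (hT : A * T = T * Matrix.diagonal (fun j => (d j : ℂ))) (f : ℝ → ℂ) :
    spec A f * T = T * Matrix.diagonal (fun j => f (d j)) := by
  set U : Matrix m m ℂ := (h.eigenvectorUnitary : Matrix m m ℂ) with hU
  have hUU : star U * U = 1 := eig_star_mul h
  have hUU' : U * star U = 1 := eig_mul_star h
  have hA : A = U * Matrix.diagonal (fun i => (h.eigenvalues i : ℂ)) * star U := by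
    rw [← spec_eq h, spec_ofReal h]
  have h1 : Matrix.diagonal (fun i => (h.eigenvalues i : ℂ)) * (star U * T)
      = (star U * T) * Matrix.diagonal (fun j => (d j : ℂ)) := by
    rw [Matrix.mul_assoc, ← hT]
    conv_rhs => rw [hA]
    simp only [← Matrix.mul_assoc]
    rw [hUU, Matrix.one_mul]
  have h2 : Matrix.diagonal (fun i => f (h.eigenvalues i)) * (star U * T)
      = (star U * T) * Matrix.diagonal (fun j => f (d j)) := by
    ext i j
    have := congrFun (congrFun h1 i) j
    rw [Matrix.diagonal_mul, Matrix.mul_diagonal] at this ⊢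
    by_cases hz : (star U * T) i j = 0
    · simp [hz]
    · rw [mul_comm] at this
      have h3 := mul_left_cancel₀ hz this
      have h4 : h.eigenvalues i = d j := by exact_mod_cast h3
      rw [h4, mul_comm]
  rw [spec_eq h, ← hU, Matrix.mul_assoc, Matrix.mul_assoc, h2, ← Matrix.mul_assoc,
    ← Matrix.mul_assoc, hUU', Matrix.one_mul]

lemma spec_intertwine {A : Matrix m m ℂ} {B : Matrix n n ℂ} (hA : A.IsHermitian)
    (hB : B.IsHermitian) {T : Matrix m n ℂ} (hT : A * T = T * B) (f : ℝ → ℂ) :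
    spec A f * T = T * spec B f := by
  set V : Matrix n n ℂ := (hB.eigenvectorUnitary : Matrix n n ℂ) with hV
  have hB' : B = V * Matrix.diagonal (fun i => (hB.eigenvalues i : ℂ)) * star V := by
    rw [← spec_eq hB, spec_ofReal hB]
  have h1 : A * (T * V) = (T * V) * Matrix.diagonal (fun j => (hB.eigenvalues j : ℂ)) := by
    rw [← Matrix.mul_assoc, hT]
    conv_lhs => rw [hB']
    simp only [Matrix.mul_assoc]
    rw [eig_star_mul hB, Matrix.mul_one]
  have h2 := spec_mul_of_diagonal hA h1 f
  calc spec A f * T = spec A f * (T * V) * star V := by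
        rw [Matrix.mul_assoc, Matrix.mul_assoc, eig_mul_star hB, Matrix.mul_one]
    _ = T * spec B f := by
        rw [h2, spec_eq hB, Matrix.mul_assoc, Matrix.mul_assoc, Matrix.mul_assoc]

lemma spec_mul {A : Matrix m m ℂ} (h : A.IsHermitian) (f g : ℝ → ℂ) :
    spec A f * spec A g = spec A (fun x => f x * g x) := by
  rw [spec_eq h, spec_eq h, spec_eq h]
  simp only [Matrix.mul_assoc]
  rw [← Matrix.mul_assoc (star _) (h.eigenvectorUnitary : Matrix m m ℂ), eig_star_mul h,
    Matrix.one_mul, ← Matrix.mul_assoc (Matrix.diagonal _), Matrix.diagonal_mul_diagonal]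

lemma spec_conjTranspose (A : Matrix m m ℂ) (f : ℝ → ℂ) :
    (spec A f)ᴴ = spec A (fun x => star (f x)) := by
  by_cases h : A.IsHermitian
  · rw [spec_eq h, spec_eq h]
    simp only [Matrix.conjTranspose_mul, Matrix.star_eq_conjTranspose,
      Matrix.conjTranspose_conjTranspose, Matrix.diagonal_conjTranspose, Matrix.mul_assoc]
    rfl
  · simp [spec, h]

lemma spec_const {A : Matrix m m ℂ} (h : A.IsHermitian) (c : ℂ) :
    spec A (fun _ => c) = c • (1 : Matrix m m ℂ) := by
  rw [spec_eq h]
  have : Matrix.diagonal (fun _ : m => c) = c • (1 : Matrix m m ℂ) := by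
    rw [← Matrix.diagonal_one, ← Matrix.diagonal_smul]; congr 1; ext; simp
  rw [this, Matrix.mul_smul, Matrix.mul_one, Matrix.smul_mul, eig_mul_star h]

lemma spec_congr {A : Matrix m m ℂ} (hA : A.PosSemidef) {f g : ℝ → ℂ}
    (h : ∀ x, 0 ≤ x → f x = g x) : spec A f = spec A g := by
  rw [spec_eq hA.1, spec_eq hA.1]
  congr 3
  ext i
  exact h _ (hA.eigenvalues_nonneg i)

lemma trace_spec {A : Matrix m m ℂ} (h : A.IsHermitian) (f : ℝ → ℂ) :
    (spec A f).trace = ∑ i, f (h.eigenvalues i) := by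
  rw [spec_eq h, Matrix.mul_assoc, Matrix.trace_mul_comm, Matrix.mul_assoc, eig_star_mul h,
    Matrix.mul_one, Matrix.trace_diagonal]

lemma spec_isHermitian (A : Matrix m m ℂ) {f : ℝ → ℂ} (hf : ∀ x, star (f x) = f x) :
    (spec A f).IsHermitian := by
  rw [Matrix.IsHermitian, spec_conjTranspose]; simp_rw [hf]

lemma spec_smul {A : Matrix m m ℂ} (h : A.IsHermitian) (c : ℝ) (f : ℝ → ℂ) :
    spec ((c : ℂ) • A) f = spec A (fun x => f (c * x)) := by
  have hc : ((c : ℂ) • A).IsHermitian := by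
    rw [Matrix.IsHermitian, Matrix.conjTranspose_smul, h.eq]; simp
  set U : Matrix m m ℂ := (h.eigenvectorUnitary : Matrix m m ℂ) with hU
  have hA : A = U * Matrix.diagonal (fun i => (h.eigenvalues i : ℂ)) * star U := by
    rw [← spec_eq h, spec_ofReal h]
  have h1 : ((c : ℂ) • A) * U = U * Matrix.diagonal (fun j => ((c * h.eigenvalues j : ℝ) : ℂ)) := by
    conv_lhs => rw [hA]
    rw [Matrix.smul_mul, Matrix.mul_assoc, eig_star_mul h, Matrix.mul_one, ← Matrix.mul_smul]
    congr 1
    ext i j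
    by_cases hij : i = j
    · subst hij; simp
    · simp [hij]
  have h2 := spec_mul_of_diagonal hc h1 f
  rw [spec_eq h, ← hU, ← h2, Matrix.mul_assoc, eig_mul_star h, Matrix.mul_one]

/-- Complex power of a nonnegative real, with `0 ^ w = 0` for every exponent. -/
def cp (w : ℂ) (x : ℝ) : ℂ := if x = 0 then 0 else Complex.exp (w * Real.log x)

lemma cp_add (w v : ℂ) (x : ℝ) : cp w x * cp v x = cp (w + v) x := by
  unfold cp
  split_ifs
  · simp
  · rw [← Complex.exp_add, add_mul]

lemma star_cp (w : ℂ) (x : ℝ) : star (cp w x) = cp (star w) x := by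
  unfold cp
  split_ifs
  · simp
  · simp [← Complex.exp_conj]

lemma cp_ofReal {x : ℝ} (hx : 0 ≤ x) {r : ℝ} (hr : r ≠ 0) : cp r x = ((x ^ r : ℝ) : ℂ) := by
  unfold cp
  split_ifs with h
  · simp [h, Real.zero_rpow hr]
  · rw [Real.rpow_def_of_pos (lt_of_le_of_ne hx (Ne.symm h))]
    push_cast
    rw [mul_comm]

/-- Complex powers of a positive semidefinite matrix, taken on its support. -/
def pw (A : Matrix m m ℂ) (w : ℂ) : Matrix m m ℂ := spec A (cp w)

lemma pw_mul {A : Matrix m m ℂ} (h : A.IsHermitian) (w v : ℂ) : pw A w * pw A v = pw A (w + v) := by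
  rw [pw, pw, spec_mul h]; simp_rw [cp_add]; rfl

lemma pw_conjTranspose (A : Matrix m m ℂ) (w : ℂ) : (pw A w)ᴴ = pw A (star w) := by
  rw [pw, spec_conjTranspose]; simp_rw [star_cp]; rfl

lemma pw_real_isHermitian (A : Matrix m m ℂ) (r : ℝ) : (pw A r).IsHermitian := by
  rw [Matrix.IsHermitian, pw_conjTranspose]; simp

lemma pw_eq_mpow {A : Matrix m m ℂ} (h : A.PosSemidef) {r : ℝ} (hr : r ≠ 0) :
    pw A r = mpow A r := by
  rw [mpow_eq_spec]; exact spec_congr h fun x hx => cp_ofReal hx hr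

lemma pw_one {A : Matrix m m ℂ} (h : A.PosSemidef) : pw A 1 = A := by
  conv_rhs => rw [← spec_ofReal h.1]
  refine spec_congr h fun x hx => ?_
  have := cp_ofReal hx (r := 1) one_ne_zero
  simpa using this

lemma pw_intertwine {A : Matrix m m ℂ} {B : Matrix n n ℂ} (hA : A.IsHermitian)
    (hB : B.IsHermitian) {T : Matrix m n ℂ} (hT : A * T = T * B) (w : ℂ) :
    pw A w * T = T * pw B w := spec_intertwine hA hB hT _

lemma cp_real_nonneg (r x : ℝ) : 0 ≤ cp r x := by
  unfold cp; split_ifs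
  · exact le_rfl
  · rw [← Complex.ofReal_mul, ← Complex.ofReal_exp]
    exact_mod_cast (Real.exp_pos _).le

lemma pw_zero_mul_self {A : Matrix m m ℂ} (h : A.PosSemidef) : pw A 0 * A = A := by
  have := pw_mul h.1 0 1
  rwa [zero_add, pw_one h] at this

lemma self_mul_pw_zero {A : Matrix m m ℂ} (h : A.PosSemidef) : A * pw A 0 = A := by
  have := pw_mul h.1 1 0
  rwa [add_zero, pw_one h] at this

lemma pw_real_mul_self {A : Matrix m m ℂ} (h : A.PosSemidef) (w : ℂ) :
    pw A w * A = pw A (w + 1) := by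
  conv_lhs => rw [← pw_one h, pw_one h]
  have := pw_mul h.1 w 1
  rwa [pw_one h] at this

lemma pw_congr_arg {A : Matrix m m ℂ} {w v : ℂ} (h : w = v) : pw A w = pw A v := by rw [h]

lemma spec_kron_right {A : Matrix m m ℂ} (h : A.IsHermitian) (f : ℝ → ℂ) :
    spec (A ⊗ₖ (1 : Matrix n n ℂ)) f = spec A f ⊗ₖ (1 : Matrix n n ℂ) := by
  have hk : (A ⊗ₖ (1 : Matrix n n ℂ)).IsHermitian := by
    rw [Matrix.IsHermitian, Matrix.conjTranspose_kronecker, h.eq, Matrix.conjTranspose_one]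
  set U : Matrix m m ℂ := (h.eigenvectorUnitary : Matrix m m ℂ) with hU
  have hA : A * U = U * Matrix.diagonal (fun i => (h.eigenvalues i : ℂ)) := by
    conv_lhs => rw [← spec_ofReal h, spec_eq h]
    rw [Matrix.mul_assoc, eig_star_mul h, Matrix.mul_one]
  have hd : ∀ g : ℝ → ℂ, Matrix.diagonal (fun i : m × n => g (h.eigenvalues i.1))
      = Matrix.diagonal (fun i => g (h.eigenvalues i)) ⊗ₖ (1 : Matrix n n ℂ) := by
    intro g
    rw [← Matrix.diagonal_one, Matrix.diagonal_kronecker_diagonal]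
    simp
  have h1 : (A ⊗ₖ (1 : Matrix n n ℂ)) * (U ⊗ₖ (1 : Matrix n n ℂ))
      = (U ⊗ₖ (1 : Matrix n n ℂ)) *
        Matrix.diagonal (fun i : m × n => (h.eigenvalues i.1 : ℂ)) := by
    rw [hd (fun x => (x : ℂ)), ← Matrix.mul_kronecker_mul, ← Matrix.mul_kronecker_mul, hA]
  have h2 := spec_mul_of_diagonal hk h1 f
  rw [hd f, ← Matrix.mul_kronecker_mul] at h2
  calc _ = spec (A ⊗ₖ (1 : Matrix n n ℂ)) f * (U ⊗ₖ (1 : Matrix n n ℂ))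
        * (star U ⊗ₖ (1 : Matrix n n ℂ)) := by
        rw [Matrix.mul_assoc, ← Matrix.mul_kronecker_mul, hU, eig_mul_star h, Matrix.one_mul,
          Matrix.one_kronecker_one, Matrix.mul_one]
    _ = _ := by
        rw [h2, ← Matrix.mul_kronecker_mul, spec_eq h]; simp [hU]

lemma spec_reindex {A : Matrix m m ℂ} (h : A.IsHermitian) (e : n ≃ m) (f : ℝ → ℂ) :
    spec (A.submatrix e e) f = (spec A f).submatrix e e := by
  have hs : (A.submatrix e e).IsHermitian := h.submatrix e
  have h1 : A.submatrix e e * (1 : Matrix m m ℂ).submatrix e id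
      = (1 : Matrix m m ℂ).submatrix e id * A := by
    rw [show A.submatrix e e * (1 : Matrix m m ℂ).submatrix e id
      = (A * 1).submatrix e id from Matrix.submatrix_mul_equiv A 1 e e id]
    rw [show (1 : Matrix m m ℂ).submatrix e id * A = (1 * A).submatrix e id from by
      have := Matrix.submatrix_mul_equiv 1 A e (Equiv.refl m) id
      simpa using this]
    simp
  have h2 := spec_intertwine hs h h1 f
  have h3 : (1 : Matrix m m ℂ).submatrix e id * (1 : Matrix m m ℂ).submatrix id e = 1 := by
    have := Matrix.submatrix_mul_equiv (1 : Matrix m m ℂ) 1 e (Equiv.refl m) e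
    simpa using this
  have h4 : (1 : Matrix m m ℂ).submatrix e id * spec A f * (1 : Matrix m m ℂ).submatrix id e
      = (spec A f).submatrix e e := by
    have h5 := Matrix.submatrix_mul_equiv (1 : Matrix m m ℂ) (spec A f) e (Equiv.refl m) id
    have h6 := Matrix.submatrix_mul_equiv (spec A f) (1 : Matrix m m ℂ) e (Equiv.refl m) e
    simp only [Equiv.coe_refl, Matrix.one_mul, Matrix.mul_one, Matrix.submatrix_id_id] at h5 h6
    rw [h5, h6]
  rw [← h4, ← h2, Matrix.mul_assoc, h3, Matrix.mul_one]

lemma spec_swap (T : Matrix m n ℂ) (f : ℝ → ℂ) :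
    T * spec (Tᴴ * T) f = spec (T * Tᴴ) f * T :=
  (spec_intertwine (Matrix.isHermitian_mul_conjTranspose_self T)
    (Matrix.isHermitian_conjTranspose_mul_self T) (Matrix.mul_assoc _ _ _) f).symm

lemma pw_zero_mul (T : Matrix m n ℂ) : pw (T * Tᴴ) 0 * T = T := by
  have hp := Matrix.posSemidef_self_mul_conjTranspose T
  have h0 : (pw (T * Tᴴ) 0 * T - T) * (pw (T * Tᴴ) 0 * T - T)ᴴ = 0 := by
    rw [Matrix.conjTranspose_sub, Matrix.conjTranspose_mul, pw_conjTranspose, star_zero]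
    have e1 : pw (T * Tᴴ) 0 * T * (Tᴴ * pw (T * Tᴴ) 0) = T * Tᴴ := by
      rw [Matrix.mul_assoc, ← Matrix.mul_assoc T, self_mul_pw_zero hp, pw_zero_mul_self hp]
    rw [Matrix.sub_mul, Matrix.mul_sub, Matrix.mul_sub, e1, Matrix.mul_assoc,
      pw_zero_mul_self hp, ← Matrix.mul_assoc, self_mul_pw_zero hp]
    simp
  exact sub_eq_zero.mp (Matrix.self_mul_conjTranspose_eq_zero.mp h0)

lemma mul_pw_zero (T : Matrix m n ℂ) : T * pw (Tᴴ * T) 0 = T := by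
  rw [pw, spec_swap]; exact pw_zero_mul T

lemma pw_mul_self {A : Matrix m m ℂ} (h : A.PosSemidef) (w : ℂ) :
    A * pw A w = pw A (1 + w) := by
  have := pw_mul h.1 1 w
  rwa [pw_one h] at this

lemma trace_pw_swap (T : Matrix m n ℂ) (w : ℂ) :
    (pw (T * Tᴴ) w).trace = (pw (Tᴴ * T) w).trace := by
  have h1 := pw_mul_self (Matrix.posSemidef_self_mul_conjTranspose T) (w - 1)
  have h2 := pw_mul_self (Matrix.posSemidef_conjTranspose_mul_self T) (w - 1)
  rw [add_sub_cancel] at h1 h2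
  rw [← h1, ← h2, Matrix.mul_assoc, Matrix.trace_mul_comm, Matrix.mul_assoc, pw, pw,
    Matrix.mul_assoc, spec_swap, Matrix.trace_mul_comm Tᴴ]


end SpectralCalculus

section HilbertSchmidt
variable {m n : Type*} [Fintype m] [Fintype n]

/-- Squared Hilbert–Schmidt norm. -/
def hs (X : Matrix m n ℂ) : ℝ := ∑ i, ∑ j, ‖X i j‖ ^ 2

lemma hs_nonneg (X : Matrix m n ℂ) : 0 ≤ hs X :=
  Finset.sum_nonneg fun _ _ => Finset.sum_nonneg fun _ _ => sq_nonneg _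

lemma trace_mul_conjTranspose_eq_hs (X : Matrix m n ℂ) : (X * Xᴴ).trace = (hs X : ℂ) := by
  simp [Matrix.trace, Matrix.mul_apply, hs, Complex.mul_conj']

lemma hs_conjTranspose (X : Matrix m n ℂ) : hs Xᴴ = hs X := by
  unfold hs; rw [Finset.sum_comm]; simp

lemma trace_conjTranspose_mul_eq_hs (X : Matrix m n ℂ) : (Xᴴ * X).trace = (hs X : ℂ) := by
  rw [← hs_conjTranspose, ← trace_mul_conjTranspose_eq_hs, Matrix.conjTranspose_conjTranspose]

lemma norm_trace_mul_le (X : Matrix m n ℂ) (Y : Matrix n m ℂ) :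
    ‖(X * Y).trace‖ ≤ √(hs X) * √(hs Y) := by
  have h1 : (X * Y).trace = ∑ p : m × n, X p.1 p.2 * Y p.2 p.1 := by
    rw [Fintype.sum_prod_type]; simp [Matrix.trace, Matrix.mul_apply]
  have h2 : hs X = ∑ p : m × n, ‖X p.1 p.2‖ ^ 2 := by rw [Fintype.sum_prod_type]; rfl
  have h3 : hs Y = ∑ p : m × n, ‖Y p.2 p.1‖ ^ 2 := by
    rw [Fintype.sum_prod_type_right]; rfl
  rw [h1, h2, h3]
  refine (norm_sum_le _ _).trans ?_
  simp_rw [norm_mul]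
  exact Real.sum_mul_le_sqrt_mul_sqrt _ _ _

end HilbertSchmidt

section Contractions
variable {k l m n : Type*} [Fintype k] [DecidableEq k] [Fintype l] [DecidableEq l]
  [Fintype m] [DecidableEq m] [Fintype n] [DecidableEq n]
open scoped Matrix.Norms.L2Operator

/-- Operator-norm contractions. -/
def Contr (C : Matrix m n ℂ) : Prop := ‖C‖ ≤ 1

lemma Contr.mul {C : Matrix l m ℂ} {C' : Matrix m n ℂ} (h : Contr C) (h' : Contr C') :
    Contr (C * C') :=
  (Matrix.l2_opNorm_mul C C').trans (mul_le_one₀ h (norm_nonneg _) h')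

lemma Contr.conjTranspose {C : Matrix m n ℂ} (h : Contr C) : Contr Cᴴ := by
  rw [Contr, Matrix.l2_opNorm_conjTranspose]; exact h

lemma contr_one : Contr (1 : Matrix m m ℂ) := by
  rw [Contr, ← Matrix.diagonal_one, Matrix.l2_opNorm_diagonal]
  exact (pi_norm_le_iff_of_nonneg zero_le_one).mpr fun i => by simp

lemma contr_of_conjTranspose_mul_self {C : Matrix m n ℂ} (h : Contr (Cᴴ * C)) : Contr C := by
  rw [Contr, Matrix.l2_opNorm_conjTranspose_mul_self] at h
  rw [Contr]; nlinarith [norm_nonneg C]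

lemma contr_of_self_mul_conjTranspose {C : Matrix m n ℂ} (h : Contr (C * Cᴴ)) : Contr C := by
  have : Contr (Cᴴᴴ * Cᴴ) := by rwa [Matrix.conjTranspose_conjTranspose]
  simpa using (contr_of_conjTranspose_mul_self this).conjTranspose

lemma star_dotProduct_self (y : m → ℂ) :
    star y ⬝ᵥ y = ((‖WithLp.toLp 2 y‖ ^ 2 : ℝ) : ℂ) := by
  rw [EuclideanSpace.norm_sq_eq]
  simp [dotProduct, Complex.conj_mul']

lemma contr_iff_posSemidef {C : Matrix m n ℂ} : Contr C ↔ (1 - Cᴴ * C).PosSemidef := by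
  have key : ∀ x : n → ℂ, star x ⬝ᵥ (1 - Cᴴ * C) *ᵥ x
      = ((‖WithLp.toLp 2 x‖ ^ 2 - ‖WithLp.toLp 2 (C *ᵥ x)‖ ^ 2 : ℝ) : ℂ) := by
    intro x
    rw [Matrix.sub_mulVec, dotProduct_sub, Matrix.one_mulVec, ← Matrix.mulVec_mulVec,
      Matrix.dotProduct_mulVec, ← Matrix.star_mulVec]
    rw [star_dotProduct_self, star_dotProduct_self, Complex.ofReal_sub]
  have hH : (1 - Cᴴ * C).IsHermitian :=
    Matrix.isHermitian_one.sub (Matrix.isHermitian_conjTranspose_mul_self C)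
  constructor
  · intro h
    refine Matrix.PosSemidef.of_dotProduct_mulVec_nonneg hH fun x => ?_
    rw [key, Complex.zero_le_real, sub_nonneg]
    have h2 : ‖WithLp.toLp 2 (C *ᵥ x)‖ ≤ ‖WithLp.toLp 2 x‖ :=
      (Matrix.l2_opNorm_mulVec C (WithLp.toLp 2 x)).trans
        (mul_le_of_le_one_left (norm_nonneg _) h)
    gcongr
  · intro h
    refine ContinuousLinearMap.opNorm_le_bound _ zero_le_one fun x => ?_
    have h2 := h.dotProduct_mulVec_nonneg x.ofLp
    rw [key, Complex.zero_le_real, sub_nonneg] at h2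
    rw [one_mul]
    exact le_of_sq_le_sq h2 (norm_nonneg _)

lemma contr_proj {p : Matrix m m ℂ} (h : pᴴ = p) (h2 : p * p = p) : Contr p := by
  have := Matrix.l2_opNorm_conjTranspose_mul_self p
  rw [h, h2] at this
  rw [Contr]; nlinarith [norm_nonneg p]

lemma contr_pw_zero {A : Matrix m m ℂ} (h : A.IsHermitian) : Contr (pw A 0) :=
  contr_proj (by rw [pw_conjTranspose, star_zero]) (by rw [pw_mul h, add_zero])

lemma contr_pw_im {A : Matrix m m ℂ} (h : A.IsHermitian) {w : ℂ} (hw : w.re = 0) :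
    Contr (pw A w) := by
  apply contr_of_conjTranspose_mul_self
  rw [pw_conjTranspose, pw_mul h]
  have : star w + w = 0 := by apply Complex.ext <;> simp [hw]
  rw [this]; exact contr_pw_zero h

lemma contr_polar (y : Matrix m n ℂ) : Contr (pw (y * yᴴ) (-1 / 2 : ℝ) * y) := by
  have hp := Matrix.posSemidef_self_mul_conjTranspose y
  apply contr_of_self_mul_conjTranspose
  rw [Matrix.conjTranspose_mul, pw_conjTranspose, Matrix.mul_assoc, ← Matrix.mul_assoc y,
    pw_mul_self hp, pw_mul hp.1]
  rw [pw_congr_arg (v := 0) (by apply Complex.ext <;> norm_num)]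
  exact contr_pw_zero hp.1

lemma Contr.one_kron {C : Matrix m n ℂ} (h : Contr C) :
    Contr ((1 : Matrix k k ℂ) ⊗ₖ C) := by
  rw [contr_iff_posSemidef] at h ⊢
  have := (Matrix.PosSemidef.one (n := k) (R := ℂ)).kronecker h
  have e : 1 - ((1 : Matrix k k ℂ) ⊗ₖ C)ᴴ * ((1 : Matrix k k ℂ) ⊗ₖ C)
      = (1 : Matrix k k ℂ) ⊗ₖ (1 - Cᴴ * C) := by
    rw [Matrix.conjTranspose_kronecker, ← Matrix.mul_kronecker_mul, ← Matrix.one_kronecker_one]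
    ext; simp only [Matrix.kroneckerMap_apply, mul_sub, Matrix.sub_apply, Matrix.mul_one,
      Matrix.conjTranspose_one]
  rw [e]; exact this

lemma Contr.kron_one {C : Matrix m n ℂ} (h : Contr C) :
    Contr (C ⊗ₖ (1 : Matrix k k ℂ)) := by
  rw [contr_iff_posSemidef] at h ⊢
  have := h.kronecker (Matrix.PosSemidef.one (n := k) (R := ℂ))
  have e : 1 - (C ⊗ₖ (1 : Matrix k k ℂ))ᴴ * (C ⊗ₖ (1 : Matrix k k ℂ))
      = (1 - Cᴴ * C) ⊗ₖ (1 : Matrix k k ℂ) := by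
    rw [Matrix.conjTranspose_kronecker, ← Matrix.mul_kronecker_mul]
    rw [← Matrix.one_kronecker_one]
    ext; simp only [Matrix.kroneckerMap_apply, sub_mul, Matrix.sub_apply, Matrix.mul_one,
      Matrix.conjTranspose_one]
  rw [e]; exact this

lemma hs_contr_mul {C : Matrix l m ℂ} (h : Contr C) (X : Matrix m n ℂ) :
    hs (C * X) ≤ hs X := by
  have h1 := ((contr_iff_posSemidef.mp h).conjTranspose_mul_mul_same X).trace_nonneg
  have h2 : Xᴴ * (1 - Cᴴ * C) * X = Xᴴ * X - (C * X)ᴴ * (C * X) := by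
    rw [Matrix.conjTranspose_mul]; simp only [Matrix.mul_sub, Matrix.sub_mul, Matrix.mul_assoc,
      Matrix.one_mul]
  rw [h2, Matrix.trace_sub, trace_conjTranspose_mul_eq_hs, trace_conjTranspose_mul_eq_hs,
    ← Complex.ofReal_sub, Complex.zero_le_real] at h1
  linarith

lemma hs_mul_contr {C : Matrix n l ℂ} (h : Contr C) (X : Matrix m n ℂ) :
    hs (X * C) ≤ hs X := by
  rw [← hs_conjTranspose, Matrix.conjTranspose_mul, ← hs_conjTranspose X]
  exact hs_contr_mul h.conjTranspose _

lemma hs_pw_half {A : Matrix m m ℂ} (h : A.PosSemidef) (r : ℝ) :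
    (hs (pw A (r / 2 : ℝ)) : ℂ) = (pw A r).trace := by
  rw [← trace_mul_conjTranspose_eq_hs, pw_conjTranspose, pw_mul h.1]
  congr 2; apply Complex.ext <;> simp

lemma norm_trace_mul_contr_le {A : Matrix m m ℂ} (h : A.PosSemidef) {C : Matrix m m ℂ}
    (hC : Contr C) : ‖(A * C).trace‖ ≤ A.trace.re := by
  have h1 : pw A (1 / 2 : ℝ) * pw A (1 / 2 : ℝ) = A := by
    rw [pw_mul h.1]
    conv_rhs => rw [← pw_one h]
    congr 1; apply Complex.ext <;> norm_num
  have h2 : (A * C).trace = (pw A (1 / 2 : ℝ) * (C * pw A (1 / 2 : ℝ))).trace := by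
    conv_lhs => rw [← h1]
    rw [Matrix.mul_assoc, Matrix.trace_mul_comm, Matrix.mul_assoc]
  have h3 : hs (pw A (1 / 2 : ℝ)) = A.trace.re := by
    have := hs_pw_half h 1
    rw [Complex.ofReal_one, pw_one h] at this
    rw [← this]; rfl
  rw [h2]
  refine (norm_trace_mul_le _ _).trans ?_
  calc _ ≤ √(hs (pw A (1 / 2 : ℝ))) * √(hs (pw A (1 / 2 : ℝ))) := by
        gcongr; exact hs_contr_mul hC _
    _ = _ := by rw [Real.mul_self_sqrt (hs_nonneg _), h3]

lemma norm_cp {x : ℝ} (w : ℂ) : ‖cp w x‖ = if x = 0 then 0 else Real.exp (w.re * Real.log x) := by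
  unfold cp; split_ifs
  · simp
  · rw [Complex.norm_exp]; simp

lemma trace_pw_real {A : Matrix m m ℂ} (h : A.IsHermitian) (r : ℝ) :
    (pw A r).trace = ((∑ i, ‖cp r (h.eigenvalues i)‖ : ℝ) : ℂ) := by
  rw [pw, trace_spec h]; push_cast
  refine Finset.sum_congr rfl fun i _ => ?_
  exact (RCLike.norm_of_nonneg' (cp_real_nonneg r _)).symm

lemma trace_pw_re_nonneg {A : Matrix m m ℂ} (h : A.IsHermitian) (r : ℝ) :
    0 ≤ (pw A r).trace.re := by
  rw [trace_pw_real h, Complex.ofReal_re]; exact Finset.sum_nonneg fun _ _ => norm_nonneg _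

lemma trace_pw_eq_re {A : Matrix m m ℂ} (h : A.IsHermitian) (r : ℝ) :
    (pw A r).trace = ((pw A r).trace.re : ℂ) := by
  rw [trace_pw_real h, Complex.ofReal_re]

lemma hs_eq_of_isometry {U : Matrix l m ℂ} (hU : Uᴴ * U = 1) (X : Matrix m n ℂ) :
    hs (U * X) = hs X := by
  have : ((hs (U * X) : ℝ) : ℂ) = hs X := by
    rw [← trace_conjTranspose_mul_eq_hs, ← trace_conjTranspose_mul_eq_hs,
      Matrix.conjTranspose_mul, Matrix.mul_assoc, ← Matrix.mul_assoc _ U, hU, Matrix.one_mul]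
  exact_mod_cast this

lemma hs_eq_of_coisometry {U : Matrix n l ℂ} (hU : U * Uᴴ = 1) (X : Matrix m n ℂ) :
    hs (X * U) = hs X := by
  rw [← hs_conjTranspose, Matrix.conjTranspose_mul, hs_eq_of_isometry (by simpa using hU),
    hs_conjTranspose]

lemma sum_weighted_le {ι κ : Type*} [Fintype ι] [Fintype κ] {s : ℝ} (hs0 : 0 < s) (hs1 : s < 1)
    (x : ι → ℝ) (y : κ → ℝ) (w : ι → κ → ℝ) (hx : ∀ i, 0 ≤ x i) (hy : ∀ j, 0 ≤ y j)
    (hw : ∀ i j, 0 ≤ w i j) (hr : ∀ i, ∑ j, w i j ≤ 1) (hc : ∀ j, ∑ i, w i j ≤ 1) :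
    ∑ i, ∑ j, x i ^ s * w i j * y j ^ (1 - s) ≤ (∑ i, x i) ^ s * (∑ j, y j) ^ (1 - s) := by
  have hconj : (1 / s).HolderConjugate (1 / (1 - s)) := by
    rw [Real.holderConjugate_iff]
    refine ⟨by rw [lt_div_iff₀ hs0]; linarith, by simp⟩
  have hs1' : 0 < 1 - s := by linarith
  have h := Real.inner_le_Lp_mul_Lq_of_nonneg (Finset.univ : Finset (ι × κ)) hconj
    (f := fun p => (x p.1 * w p.1 p.2) ^ s) (g := fun p => (y p.2 * w p.1 p.2) ^ (1 - s))
    (fun p _ => Real.rpow_nonneg (mul_nonneg (hx _) (hw _ _)) _)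
    (fun p _ => Real.rpow_nonneg (mul_nonneg (hy _) (hw _ _)) _)
  have e1 : ∀ p : ι × κ, ((x p.1 * w p.1 p.2) ^ s) ^ (1 / s) = x p.1 * w p.1 p.2 := fun p => by
    rw [← Real.rpow_mul (mul_nonneg (hx _) (hw _ _)), mul_one_div_cancel hs0.ne', Real.rpow_one]
  have e2 : ∀ p : ι × κ, ((y p.2 * w p.1 p.2) ^ (1 - s)) ^ (1 / (1 - s)) = y p.2 * w p.1 p.2 :=
    fun p => by
    rw [← Real.rpow_mul (mul_nonneg (hy _) (hw _ _)), mul_one_div_cancel hs1'.ne', Real.rpow_one]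
  have e3 : ∀ p : ι × κ, (x p.1 * w p.1 p.2) ^ s * (y p.2 * w p.1 p.2) ^ (1 - s)
      = x p.1 ^ s * w p.1 p.2 * y p.2 ^ (1 - s) := fun p => by
    rw [Real.mul_rpow (hx _) (hw _ _), Real.mul_rpow (hy _) (hw _ _)]
    have : w p.1 p.2 ^ s * w p.1 p.2 ^ (1 - s) = w p.1 p.2 := by
      rw [← Real.rpow_add_of_nonneg (hw _ _) hs0.le hs1'.le]; simp
    linear_combination (x p.1 ^ s * y p.2 ^ (1 - s)) * this
  simp_rw [e1, e2, e3] at h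
  rw [Fintype.sum_prod_type, one_div_one_div, one_div_one_div] at h
  refine h.trans ?_
  have a1 : ∑ p : ι × κ, x p.1 * w p.1 p.2 ≤ ∑ i, x i := by
    rw [Fintype.sum_prod_type]
    refine Finset.sum_le_sum fun i _ => ?_
    simp only []; rw [← Finset.mul_sum]; exact mul_le_of_le_one_right (hx i) (hr i)
  have a2 : ∑ p : ι × κ, y p.2 * w p.1 p.2 ≤ ∑ j, y j := by
    rw [Fintype.sum_prod_type_right]
    refine Finset.sum_le_sum fun j _ => ?_
    simp only []; rw [← Finset.mul_sum]; exact mul_le_of_le_one_right (hy j) (hc j)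
  have b1 : 0 ≤ ∑ p : ι × κ, x p.1 * w p.1 p.2 :=
    Finset.sum_nonneg fun p _ => mul_nonneg (hx _) (hw _ _)
  have b2 : 0 ≤ ∑ p : ι × κ, y p.2 * w p.1 p.2 :=
    Finset.sum_nonneg fun p _ => mul_nonneg (hy _) (hw _ _)
  have b3 : 0 ≤ ∑ i, x i := Finset.sum_nonneg fun i _ => hx i
  gcongr

lemma Contr.row_sum_le {W : Matrix m n ℂ} (h : Contr W) (i : m) : ∑ j, ‖W i j‖ ^ 2 ≤ 1 := by
  have h1 := (contr_iff_posSemidef.mp h.conjTranspose).diag_nonneg (i := i)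
  rw [Matrix.conjTranspose_conjTranspose] at h1
  have : (1 - W * Wᴴ : Matrix m m ℂ) i i = ((1 - ∑ j, ‖W i j‖ ^ 2 : ℝ) : ℂ) := by
    simp [Matrix.mul_apply, Complex.mul_conj']
  rw [this, Complex.zero_le_real] at h1
  linarith

lemma Contr.col_sum_le {W : Matrix m n ℂ} (h : Contr W) (j : n) : ∑ i, ‖W i j‖ ^ 2 ≤ 1 := by
  have := h.conjTranspose.row_sum_le j
  simpa using this

/-- A noncommutative Hölder inequality. -/
lemma hs_holder {A : Matrix m m ℂ} {B : Matrix n n ℂ} (hA : A.PosSemidef) (hB : B.PosSemidef)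
    {C : Matrix m n ℂ} (hC : Contr C) {s a b : ℝ} (hs0 : 0 < s) (hs1 : s < 1) :
    hs (pw A (s * a / 2 : ℝ) * C * pw B ((1 - s) * b / 2 : ℝ))
      ≤ (pw A a).trace.re ^ s * (pw B b).trace.re ^ (1 - s) := by
  set U : Matrix m m ℂ := (hA.1.eigenvectorUnitary : Matrix m m ℂ) with hU
  set V : Matrix n n ℂ := (hB.1.eigenvectorUnitary : Matrix n n ℂ) with hV
  have hUU : Uᴴ * U = 1 := eig_star_mul hA.1
  have hVV : Vᴴ * V = 1 := eig_star_mul hB.1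
  have hW : Contr (Uᴴ * C * V) := by
    refine ((contr_of_self_mul_conjTranspose ?_).mul hC).mul (contr_of_conjTranspose_mul_self ?_)
    · rw [Matrix.conjTranspose_conjTranspose, hUU]; exact contr_one
    · rw [hVV]; exact contr_one
  set W := Uᴴ * C * V with hWdef
  have e1 : pw A (s * a / 2 : ℝ) * C * pw B ((1 - s) * b / 2 : ℝ)
      = U * (Matrix.diagonal (fun i => cp (s * a / 2 : ℝ) (hA.1.eigenvalues i)) * W *
        Matrix.diagonal (fun j => cp ((1 - s) * b / 2 : ℝ) (hB.1.eigenvalues j)) * Vᴴ) := by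
    rw [pw, pw, spec_eq hA.1, spec_eq hB.1, hWdef]
    simp only [Matrix.mul_assoc, Matrix.star_eq_conjTranspose]; rfl
  rw [e1, hs_eq_of_isometry hUU, hs_eq_of_coisometry (by simpa using hVV), trace_pw_real hA.1,
    trace_pw_real hB.1, Complex.ofReal_re, Complex.ofReal_re]
  refine le_trans (le_of_eq ?_) (sum_weighted_le hs0 hs1 _ _ (fun i j => ‖W i j‖ ^ 2)
    (fun i => norm_nonneg _) (fun i => norm_nonneg _) (fun i j => sq_nonneg _)
    (fun i => hW.row_sum_le i) (fun j => hW.col_sum_le j))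
  unfold hs
  have key : ∀ (r c x : ℝ), 0 < r → ‖cp (r * c / 2 : ℝ) x‖ ^ 2 = ‖cp c x‖ ^ r := by
    intro r c x hr
    rw [norm_cp, norm_cp]
    split_ifs
    · rw [Real.zero_rpow hr.ne']; simp
    · rw [← Real.exp_mul, ← Real.exp_nat_mul]; congr 1; simp; ring
  refine Finset.sum_congr rfl fun i _ => Finset.sum_congr rfl fun j _ => ?_
  rw [Matrix.mul_diagonal, Matrix.diagonal_mul, norm_mul, norm_mul, mul_pow, mul_pow,
    key s a _ hs0, key (1 - s) b _ (by linarith)]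

end Contractions

section ThreeLines
variable {l m n : Type*} [Fintype l] [Fintype m] [Fintype n]

/-- Entire functions that are bounded on the strip `0 ≤ re z ≤ 1`. -/
def StripBdd (f : ℂ → ℂ) : Prop :=
  Differentiable ℂ f ∧ ∃ C : ℝ, ∀ z : ℂ, 0 ≤ z.re → z.re ≤ 1 → ‖f z‖ ≤ C

lemma StripBdd.const (c : ℂ) : StripBdd fun _ => c :=
  ⟨differentiable_const c, ‖c‖, fun _ _ _ => le_rfl⟩

lemma StripBdd.mul {f g : ℂ → ℂ} (hf : StripBdd f) (hg : StripBdd g) :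
    StripBdd fun z => f z * g z := by
  obtain ⟨hf, C, hC⟩ := hf
  obtain ⟨hg, C', hC'⟩ := hg
  refine ⟨hf.mul hg, C * C', fun z h0 h1 => ?_⟩
  rw [norm_mul]
  exact mul_le_mul (hC z h0 h1) (hC' z h0 h1) (norm_nonneg _)
    ((norm_nonneg _).trans (hC z h0 h1))

lemma StripBdd.sum {ι : Type*} (s : Finset ι) {f : ι → ℂ → ℂ} (hf : ∀ i, StripBdd (f i)) :
    StripBdd fun z => ∑ i ∈ s, f i z := by
  choose hd C hC using hf
  refine ⟨Differentiable.fun_sum fun i _ => hd i, ∑ i ∈ s, C i, fun z h0 h1 => ?_⟩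
  exact (norm_sum_le _ _).trans (Finset.sum_le_sum fun i _ => hC i z h0 h1)

lemma StripBdd.cp (a : ℝ) (b : ℂ) (x : ℝ) : StripBdd fun z => cp (a * z + b) x := by
  unfold QITLeak.cp
  split_ifs
  · exact StripBdd.const 0
  · refine ⟨by fun_prop, Real.exp ((|a| + |b.re|) * |Real.log x|), fun z h0 h1 => ?_⟩
    rw [Complex.norm_exp]
    apply Real.exp_le_exp.mpr
    have h2 : ((a * z + b) * (Real.log x : ℂ)).re = (a * z.re + b.re) * Real.log x := by simp
    rw [h2]
    refine (le_abs_self _).trans ?_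
    rw [abs_mul]
    refine mul_le_mul_of_nonneg_right ?_ (abs_nonneg _)
    refine (abs_add_le _ _).trans (add_le_add ?_ le_rfl)
    rw [abs_mul, abs_of_nonneg h0]
    exact mul_le_of_le_one_right (abs_nonneg _) h1

/-- Matrix-valued functions with entries in `StripBdd`. -/
def MStrip (F : ℂ → Matrix m n ℂ) : Prop := ∀ i j, StripBdd fun z => F z i j

lemma MStrip.const (C : Matrix m n ℂ) : MStrip fun _ => C := fun i j => StripBdd.const (C i j)

lemma MStrip.mul {F : ℂ → Matrix l m ℂ} {G : ℂ → Matrix m n ℂ} (hF : MStrip F)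
    (hG : MStrip G) : MStrip fun z => F z * G z := by
  intro i j
  simp_rw [Matrix.mul_apply]
  exact StripBdd.sum _ fun k => (hF i k).mul (hG k j)

lemma MStrip.trace {F : ℂ → Matrix m m ℂ} (hF : MStrip F) : StripBdd fun z => (F z).trace := by
  unfold Matrix.trace
  exact StripBdd.sum _ fun k => hF k k

lemma MStrip.smul {f : ℂ → ℂ} {F : ℂ → Matrix m n ℂ} (hf : StripBdd f) (hF : MStrip F) :
    MStrip fun z => f z • F z := fun i j => hf.mul (hF i j)

lemma MStrip.pw [DecidableEq m] {A : Matrix m m ℂ} (h : A.IsHermitian) (a : ℝ) (b : ℂ) :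
    MStrip fun z => pw A (a * z + b) := by
  simp only [QITLeak.pw, spec_eq h]
  refine ((MStrip.const _).mul ?_).mul (MStrip.const _)
  intro i j
  by_cases hij : i = j
  · subst hij; simpa using StripBdd.cp a b _
  · simpa [hij] using StripBdd.const 0

lemma MStrip.kron_one [DecidableEq l] {F : ℂ → Matrix m n ℂ} (hF : MStrip F) :
    MStrip fun z => F z ⊗ₖ (1 : Matrix l l ℂ) := by
  intro i j
  simp only [Matrix.kroneckerMap_apply]
  exact (hF _ _).mul (StripBdd.const _)

lemma MStrip.one_kron [DecidableEq l] {F : ℂ → Matrix m n ℂ} (hF : MStrip F) :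
    MStrip fun z => (1 : Matrix l l ℂ) ⊗ₖ F z := by
  intro i j
  simp only [Matrix.kroneckerMap_apply]
  exact (StripBdd.const _).mul (hF _ _)

lemma StripBdd.three_lines {f : ℂ → ℂ} (hf : StripBdd f) {a b θ : ℝ}
    (ha : ∀ z : ℂ, z.re = 0 → ‖f z‖ ≤ a) (hb : ∀ z : ℂ, z.re = 1 → ‖f z‖ ≤ b)
    (h0 : 0 ≤ θ) (h1 : θ ≤ 1) : ‖f θ‖ ≤ a ^ (1 - θ) * b ^ θ := by
  obtain ⟨hd, C, hC⟩ := hf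
  have := Complex.HadamardThreeLines.norm_le_interp_of_mem_verticalClosedStrip₀₁'
    f (z := (θ : ℂ)) (a := a) (b := b) ⟨by simpa using h0, by simpa using h1⟩ hd.diffContOnCl
    ⟨C, by rintro _ ⟨z, hz, rfl⟩; exact hC z hz.1 hz.2⟩ (fun z hz => ha z hz) (fun z hz => hb z hz)
  simpa using this

end ThreeLines

lemma le_of_le_rpow_mul_rpow {Q a s : ℝ} (hQ : 0 ≤ Q) (ha : 0 ≤ a) (hs : s < 1)
    (h : Q ≤ a ^ (1 - s) * Q ^ s) : Q ≤ a := by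
  rcases hQ.eq_or_lt with rfl | hQ
  · exact ha
  · have h1 : Q ^ (1 - s) ≤ a ^ (1 - s) := by
      rw [Real.rpow_sub hQ, Real.rpow_one, div_le_iff₀ (Real.rpow_pos_of_pos hQ s)]
      exact h
    exact (Real.rpow_le_rpow_iff hQ.le ha (by linarith)).mp h1

section DataProcessing
variable {J K ι : Type*} [Fintype J] [DecidableEq J] [Fintype K] [DecidableEq K]
  [Fintype ι] [DecidableEq ι]

lemma ptB_posSemidef {M : Matrix (K × ι) (K × ι) ℂ} (h : M.PosSemidef) : (ptB M).PosSemidef := by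
  have : ptB M = ∑ b, M.submatrix (fun a => (a, b)) (fun a => (a, b)) := by
    ext i j; simp [ptB, Matrix.sum_apply]
  rw [this]
  exact Matrix.posSemidef_sum _ fun b _ => h.submatrix _

lemma trace_mul_kron_one (M : Matrix (K × ι) (K × ι) ℂ) (B : Matrix K K ℂ) :
    (M * (B ⊗ₖ (1 : Matrix ι ι ℂ))).trace = (ptB M * B).trace := by
  simp only [Matrix.trace, Matrix.diag, Matrix.mul_apply, Fintype.sum_prod_type,
    Matrix.kroneckerMap_apply, Matrix.one_apply, ptB, Matrix.of_apply, Finset.sum_mul,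
    mul_ite, mul_one, mul_zero, Finset.sum_ite_eq', Finset.mem_univ, if_true]
  refine Finset.sum_congr rfl fun a _ => ?_
  rw [Finset.sum_comm]

lemma pw_add' {A : Matrix J J ℂ} (h : A.IsHermitian) {u v w : ℂ} (e : w = u + v) :
    pw A w = pw A u * pw A v := by rw [pw_mul h, e]

/-- The sandwiched operator `X^{-s/2} N X^{-s/2}`. -/
def sandw (s : ℝ) (X N : Matrix J J ℂ) : Matrix J J ℂ :=
  pw X (-s / 2 : ℝ) * N * pw X (-s / 2 : ℝ)

lemma sandw_posSemidef (s : ℝ) {X N : Matrix J J ℂ} (hN : N.PosSemidef) :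
    (sandw s X N).PosSemidef := by
  have := hN.mul_mul_conjTranspose_same (pw X (-s / 2 : ℝ))
  rwa [(pw_real_isHermitian X _).eq] at this

/-- Data processing for the sandwiched quantity under `x ↦ Tr_ι (V x V†)` with `V` a
contraction. -/
lemma trace_sandw_ptB_le {V : Matrix (K × ι) J ℂ} (hV : Contr V) {X0 N0 : Matrix J J ℂ}
    (hX0 : X0.PosSemidef) (hN0 : N0.PosSemidef) (hsupp : N0 * pw X0 0 = N0)
    {s q : ℝ} (hs0 : 0 < s) (hs1 : s < 1) (hq : q = 1 / (1 - s)) :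
    (pw (sandw s (ptB (V * X0 * Vᴴ)) (ptB (V * N0 * Vᴴ))) q).trace.re
      ≤ (pw (sandw s X0 N0) q).trace.re := by
  have hqs : q * (1 - s) = 1 := by rw [hq]; field_simp [show (1 - s) ≠ 0 by linarith]
  set X := ptB (V * X0 * Vᴴ) with hXdef
  set N := ptB (V * N0 * Vᴴ) with hNdef
  have hX : X.PosSemidef := ptB_posSemidef (hX0.mul_mul_conjTranspose_same V)
  have hN : N.PosSemidef := ptB_posSemidef (hN0.mul_mul_conjTranspose_same V)
  set Y0 := sandw s X0 N0 with hY0def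
  set Y := sandw s X N with hYdef
  have hY0 : Y0.PosSemidef := sandw_posSemidef s hN0
  have hY : Y.PosSemidef := sandw_posSemidef s hN
  have hsupp' : pw X0 0 * N0 = N0 := by
    have := congrArg Matrix.conjTranspose hsupp
    rwa [Matrix.conjTranspose_mul, hN0.1.eq, pw_conjTranspose, star_zero] at this
  have hN0' : pw X0 (s / 2 : ℝ) * Y0 * pw X0 (s / 2 : ℝ) = N0 := by
    have e1 : pw X0 (s / 2 : ℝ) * pw X0 (-s / 2 : ℝ) = pw X0 0 := by
      rw [pw_mul hX0.1]; congr 1; push_cast; ring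
    have e2 : pw X0 (-s / 2 : ℝ) * pw X0 (s / 2 : ℝ) = pw X0 0 := by
      rw [pw_mul hX0.1]; congr 1; push_cast; ring
    rw [hY0def, sandw]
    calc _ = (pw X0 (s / 2 : ℝ) * pw X0 (-s / 2 : ℝ)) * N0 *
          (pw X0 (-s / 2 : ℝ) * pw X0 (s / 2 : ℝ)) := by simp only [Matrix.mul_assoc]
      _ = N0 := by rw [e1, e2, hsupp', hsupp]
  set Q := (pw Y q).trace.re with hQ
  set Q0 := (pw Y0 q).trace.re with hQ0
  have hQnn : 0 ≤ Q := trace_pw_re_nonneg hY.1 q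
  have hQ0nn : 0 ≤ Q0 := trace_pw_re_nonneg hY0.1 q
  -- the interpolating family
  set L : ℂ → Matrix J J ℂ := fun z =>
    pw Y0 ((-q / 2 : ℝ) * z + (q / 2 : ℝ)) * pw X0 ((1 / 2 : ℝ) * z + 0) with hL
  set B : ℂ → Matrix K K ℂ := fun z =>
    pw X ((-1 / 2 : ℝ) * z + 0) * pw Y ((q / 2 : ℝ) * z + 0) with hB
  set H : ℂ → Matrix J (K × ι) ℂ := fun z => L z * Vᴴ * (B z ⊗ₖ (1 : Matrix ι ι ℂ)) with hH
  have hsH : ∀ (A : Matrix J J ℂ) (C : Matrix K K ℂ),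
      (hs (A * Vᴴ * (C ⊗ₖ (1 : Matrix ι ι ℂ))) : ℂ)
        = (ptB (V * (Aᴴ * A) * Vᴴ) * (C * Cᴴ)).trace := by
    intro A C
    rw [← trace_mul_kron_one, ← trace_mul_conjTranspose_eq_hs, Matrix.conjTranspose_mul,
      Matrix.conjTranspose_mul, Matrix.conjTranspose_conjTranspose, Matrix.trace_mul_comm,
      Matrix.conjTranspose_kronecker, Matrix.conjTranspose_one]
    have : (C * Cᴴ) ⊗ₖ (1 : Matrix ι ι ℂ)
        = (C ⊗ₖ (1 : Matrix ι ι ℂ)) * (Cᴴ ⊗ₖ (1 : Matrix ι ι ℂ)) := by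
      rw [← Matrix.mul_kronecker_mul, Matrix.mul_one]
    rw [this, ← Matrix.mul_assoc _ (C ⊗ₖ (1 : Matrix ι ι ℂ)), Matrix.trace_mul_comm _ (Cᴴ ⊗ₖ _)]
    simp only [Matrix.mul_assoc]
  have hs_s : hs (H s) = Q := by
    have : (hs (H s) : ℂ) = (pw Y q).trace := by
      rw [hH, hsH]
      have e1 : (L s)ᴴ * L s = N0 := by
        rw [hL]
        simp only [Matrix.conjTranspose_mul, pw_conjTranspose]
        rw [Matrix.mul_assoc, ← Matrix.mul_assoc (pw Y0 _), pw_mul hY0.1]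
        have a1 : star ((-q / 2 : ℝ) * (s : ℂ) + (q / 2 : ℝ)) + ((-q / 2 : ℝ) * (s : ℂ) + (q / 2 : ℝ))
            = 1 := by
          have : (q : ℂ) * (1 - s) = 1 := by exact_mod_cast hqs
          simp; linear_combination this
        have a2 : star ((1 / 2 : ℝ) * (s : ℂ) + 0) = ((s / 2 : ℝ) : ℂ) := by
          simp; ring
        have a3 : ((1 / 2 : ℝ) * (s : ℂ) + 0) = ((s / 2 : ℝ) : ℂ) := by
          push_cast; ring
        rw [a1, a2, a3, pw_one hY0, ← Matrix.mul_assoc, hN0']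
      have e2 : B s * (B s)ᴴ = pw X (-s / 2 : ℝ) * pw Y (q * s : ℝ) * pw X (-s / 2 : ℝ) := by
        rw [hB]
        simp only [Matrix.conjTranspose_mul, pw_conjTranspose]
        rw [Matrix.mul_assoc, ← Matrix.mul_assoc (pw Y _), pw_mul hY.1, Matrix.mul_assoc]
        have a1 : ((-1 / 2 : ℝ) * (s : ℂ) + 0) = ((-s / 2 : ℝ) : ℂ) := by push_cast; ring
        have a2 : star ((-1 / 2 : ℝ) * (s : ℂ) + 0) = ((-s / 2 : ℝ) : ℂ) := by
          rw [a1]; exact Complex.conj_ofReal _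
        have a3 : ((q / 2 : ℝ) * (s : ℂ) + 0) + star ((q / 2 : ℝ) * (s : ℂ) + 0)
            = ((q * s : ℝ) : ℂ) := by simp; ring
        rw [a2, a1, a3]
      rw [e1, e2, ← hNdef]
      have e3 : N * (pw X (-s / 2 : ℝ) * pw Y (q * s : ℝ) * pw X (-s / 2 : ℝ))
          = (N * pw X (-s / 2 : ℝ) * pw Y (q * s : ℝ)) * pw X (-s / 2 : ℝ) := by
        simp only [Matrix.mul_assoc]
      rw [e3, Matrix.trace_mul_comm, ← Matrix.mul_assoc, ← Matrix.mul_assoc]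
      change (Y * pw Y (q * s : ℝ)).trace = _
      rw [pw_mul_self hY]
      congr 2
      have : (q : ℂ) * (1 - s) = 1 := by exact_mod_cast hqs
      push_cast
      linear_combination -this
    rw [hQ, ← this]; rfl
  have hY0half : hs (pw Y0 (q / 2 : ℝ)) = Q0 := by
    rw [hQ0, ← hs_pw_half hY0]; rfl
  have hYhalf : hs (pw Y (q / 2 : ℝ)) = Q := by
    rw [hQ, ← hs_pw_half hY]; rfl
  have hst : StripBdd fun z => ((H s)ᴴ * H z).trace := by
    refine ((MStrip.const _).mul ?_).trace
    exact (((MStrip.pw hY0.1 _ _).mul (MStrip.pw hX0.1 _ _)).mul (MStrip.const _)).mul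
      ((MStrip.pw hX.1 _ _).mul (MStrip.pw hY.1 _ _)).kron_one
  have hcs : ∀ z, ‖((H s)ᴴ * H z).trace‖ ≤ √Q * √(hs (H z)) := by
    intro z
    refine (norm_trace_mul_le _ _).trans ?_
    rw [hs_conjTranspose, hs_s]
  have h0 : ∀ z : ℂ, z.re = 0 → ‖((H s)ᴴ * H z).trace‖ ≤ √Q * √Q0 := by
    intro z hz
    refine (hcs z).trans ?_
    gcongr
    rw [← hY0half, hH, hL, hB]
    simp only
    rw [pw_add' hY0.1 (u := (q / 2 : ℝ)) (v := (-q / 2 : ℝ) * z) (by ring)]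
    simp only [Matrix.mul_assoc]
    refine hs_mul_contr ?_ _
    refine (contr_pw_im hY0.1 (by simp [hz])).mul ((contr_pw_im hX0.1 (by simp [hz])).mul
      (hV.conjTranspose.mul (Contr.kron_one ?_)))
    exact (contr_pw_im hX.1 (by simp [hz])).mul (contr_pw_im hY.1 (by simp [hz]))
  have h1 : ∀ z : ℂ, z.re = 1 → ‖((H s)ᴴ * H z).trace‖ ≤ Q := by
    intro z hz
    refine (hcs z).trans ?_
    suffices h : hs (H z) ≤ Q by
      calc √Q * √(hs (H z)) ≤ √Q * √Q := by gcongr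
        _ = Q := Real.mul_self_sqrt hQnn
    set Dm : Matrix K K ℂ := pw X ((-1 / 2 : ℝ) * (z - 1)) *
      (pw Y ((q / 2 : ℝ) * (z - 1)) * pw Y (q / 2 : ℝ)) with hD
    have e1 : H z = (pw Y0 ((-q / 2 : ℝ) * z + (q / 2 : ℝ)) * pw X0 ((1 / 2 : ℝ) * (z - 1))) *
        (pw X0 (1 / 2 : ℝ) * Vᴴ * ((pw X (-1 / 2 : ℝ) * Dm) ⊗ₖ (1 : Matrix ι ι ℂ))) := by
      rw [hH, hL, hB, hD]
      simp only
      rw [pw_add' hX0.1 (w := (1 / 2 : ℝ) * z + 0) (u := (1 / 2 : ℝ) * (z - 1)) (v := (1 / 2 : ℝ))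
          (by push_cast; ring),
        pw_add' hX.1 (w := (-1 / 2 : ℝ) * z + 0) (u := (-1 / 2 : ℝ)) (v := (-1 / 2 : ℝ) * (z - 1))
          (by push_cast; ring),
        pw_add' hY.1 (w := (q / 2 : ℝ) * z + 0) (u := (q / 2 : ℝ) * (z - 1)) (v := (q / 2 : ℝ))
          (by push_cast; ring)]
      simp only [Matrix.mul_assoc]
    rw [e1]
    refine (hs_contr_mul ((contr_pw_im hY0.1 (by simp [hz]; ring)).mul
      (contr_pw_im hX0.1 (by simp [hz]))) _).trans ?_
    have e2 : ∀ Dm : Matrix K K ℂ,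
        hs (pw X0 (1 / 2 : ℝ) * Vᴴ * ((pw X (-1 / 2 : ℝ) * Dm) ⊗ₖ (1 : Matrix ι ι ℂ)))
          = hs (pw X 0 * Dm) := by
      intro Dm
      have : (hs (pw X0 (1 / 2 : ℝ) * Vᴴ * ((pw X (-1 / 2 : ℝ) * Dm) ⊗ₖ (1 : Matrix ι ι ℂ))) : ℂ)
          = hs (pw X 0 * Dm) := by
        rw [hsH, (pw_real_isHermitian X0 _).eq, pw_mul hX0.1]
        rw [pw_congr_arg (v := 1) (by push_cast; ring), pw_one hX0, ← hXdef,
          Matrix.conjTranspose_mul, (pw_real_isHermitian X _).eq]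
        have e5 : X * (pw X (-1 / 2 : ℝ) * Dm * (Dmᴴ * pw X (-1 / 2 : ℝ)))
            = (X * pw X (-1 / 2 : ℝ) * Dm * Dmᴴ) * pw X (-1 / 2 : ℝ) := by
          simp only [Matrix.mul_assoc]
        rw [e5, Matrix.trace_mul_comm, ← trace_mul_conjTranspose_eq_hs, Matrix.conjTranspose_mul,
          pw_conjTranspose, star_zero, ← Matrix.mul_assoc, ← Matrix.mul_assoc, ← Matrix.mul_assoc,
          pw_real_mul_self hX, pw_mul hX.1, ← Matrix.mul_assoc, Matrix.trace_mul_comm _ (pw X 0),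
          ← Matrix.mul_assoc, ← Matrix.mul_assoc, pw_mul hX.1]
        rw [pw_congr_arg (v := 0) (by push_cast; ring), pw_congr_arg (w := 0 + 0) (v := 0) (by ring)]
      exact_mod_cast this
    rw [e2]
    refine (hs_contr_mul (contr_pw_zero hX.1) _).trans ?_
    rw [hD]
    refine (hs_contr_mul (contr_pw_im hX.1 (by simp [hz])) _).trans ?_
    refine (hs_contr_mul (contr_pw_im hY.1 (by simp [hz])) _).trans ?_
    rw [hYhalf]
  have h3 := hst.three_lines h0 h1 hs0.le hs1.le
  rw [trace_conjTranspose_mul_eq_hs, hs_s, Complex.norm_real, Real.norm_of_nonneg hQnn] at h3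
  have h4 := le_of_le_rpow_mul_rpow hQnn (by positivity) hs1 h3
  have h5 : √Q * √Q = Q := Real.mul_self_sqrt hQnn
  by_contra hcon
  push Not at hcon
  have h6 : √Q0 < √Q := Real.sqrt_lt_sqrt hQ0nn hcon
  have h7 : 0 < √Q := lt_of_le_of_lt (Real.sqrt_nonneg _) h6
  nlinarith

end DataProcessing

section Reshape
variable {K T F F' : Type*} [Fintype K] [DecidableEq K] [Fintype T] [DecidableEq T]
  [Fintype F] [DecidableEq F] [Fintype F'] [DecidableEq F']

/-- Move the first column register to the rows. -/
def sh (G : Matrix K (T × F) ℂ) : Matrix (K × T) F ℂ := Matrix.of fun a f => G a.1 (a.2, f)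

lemma sh_mul (B : Matrix K K ℂ) (G : Matrix K (T × F) ℂ) :
    sh (B * G) = (B ⊗ₖ (1 : Matrix T T ℂ)) * sh G := by
  ext a f
  simp [sh, Matrix.mul_apply, Fintype.sum_prod_type, Matrix.one_apply]

lemma sh_mul_one_kron (G : Matrix K (T × F) ℂ) (C : Matrix F F' ℂ) :
    sh (G * ((1 : Matrix T T ℂ) ⊗ₖ C)) = sh G * C := by
  ext a f
  simp [sh, Matrix.mul_apply, Fintype.sum_prod_type, Matrix.one_apply]

lemma sh_smul (c : ℂ) (G : Matrix K (T × F) ℂ) : sh (c • G) = c • sh G := rfl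

lemma hs_sh (G : Matrix K (T × F) ℂ) : hs (sh G) = hs G := by
  simp [hs, sh, Fintype.sum_prod_type]

lemma pw_kron_one {A : Matrix K K ℂ} (h : A.IsHermitian) (w : ℂ) :
    pw (A ⊗ₖ (1 : Matrix T T ℂ)) w = pw A w ⊗ₖ (1 : Matrix T T ℂ) := spec_kron_right h _

lemma one_kron_eq_submatrix (A : Matrix K K ℂ) :
    (1 : Matrix T T ℂ) ⊗ₖ A
      = (A ⊗ₖ (1 : Matrix T T ℂ)).submatrix (Equiv.prodComm T K) (Equiv.prodComm T K) := by
  ext ⟨i1, i2⟩ ⟨j1, j2⟩; simp [mul_comm]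

lemma pw_one_kron {A : Matrix K K ℂ} (h : A.IsHermitian) (w : ℂ) :
    pw ((1 : Matrix T T ℂ) ⊗ₖ A) w = (1 : Matrix T T ℂ) ⊗ₖ pw A w := by
  have hk : (A ⊗ₖ (1 : Matrix T T ℂ)).IsHermitian := by
    rw [Matrix.IsHermitian, Matrix.conjTranspose_kronecker, h.eq, Matrix.conjTranspose_one]
  rw [one_kron_eq_submatrix, one_kron_eq_submatrix, ← pw_kron_one h]
  exact spec_reindex hk _ _

lemma one_kron_mul {F₁ F₂ F₃ : Type*} [Fintype F₂] (A : Matrix F₁ F₂ ℂ) (C : Matrix F₂ F₃ ℂ) :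
    ((1 : Matrix T T ℂ) ⊗ₖ A) * ((1 : Matrix T T ℂ) ⊗ₖ C) = (1 : Matrix T T ℂ) ⊗ₖ (A * C) := by
  rw [← Matrix.mul_kronecker_mul, Matrix.one_mul]

lemma one_kron_conjTranspose {F₁ F₂ : Type*} (A : Matrix F₁ F₂ ℂ) :
    ((1 : Matrix T T ℂ) ⊗ₖ A)ᴴ = (1 : Matrix T T ℂ) ⊗ₖ Aᴴ := by
  rw [Matrix.conjTranspose_kronecker, Matrix.conjTranspose_one]

/-- The sandwiched quantity of `sh G (sh G)†` relative to its own marginal `G G†`. -/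
def cq (s q : ℝ) (G : Matrix K (T × F) ℂ) : ℝ :=
  (pw (sh (pw (G * Gᴴ) (-s / 2 : ℝ) * G) * (sh (pw (G * Gᴴ) (-s / 2 : ℝ) * G))ᴴ) q).trace.re

lemma cq_nonneg (s q : ℝ) (G : Matrix K (T × F) ℂ) : 0 ≤ cq s q G :=
  trace_pw_re_nonneg (Matrix.isHermitian_mul_conjTranspose_self _) q

lemma sandw_kron_eq (s : ℝ) (G : Matrix K (T × F) ℂ) :
    sandw s ((G * Gᴴ) ⊗ₖ (1 : Matrix T T ℂ)) (sh G * (sh G)ᴴ)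
      = sh (pw (G * Gᴴ) (-s / 2 : ℝ) * G) * (sh (pw (G * Gᴴ) (-s / 2 : ℝ) * G))ᴴ := by
  rw [sandw, pw_kron_one (Matrix.isHermitian_mul_conjTranspose_self G), sh_mul,
    Matrix.conjTranspose_mul, Matrix.conjTranspose_kronecker, (pw_real_isHermitian _ _).eq,
    Matrix.conjTranspose_one]
  simp only [Matrix.mul_assoc]

lemma cq_eq_sandw (s q : ℝ) (G : Matrix K (T × F) ℂ) :
    cq s q G = (pw (sandw s ((G * Gᴴ) ⊗ₖ (1 : Matrix T T ℂ)) (sh G * (sh G)ᴴ)) q).trace.re := by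
  rw [sandw_kron_eq]; rfl

lemma sh_mul_conjTranspose_supp (G : Matrix K (T × F) ℂ) :
    (sh G * (sh G)ᴴ) * pw ((G * Gᴴ) ⊗ₖ (1 : Matrix T T ℂ)) 0 = sh G * (sh G)ᴴ := by
  have hG := Matrix.isHermitian_mul_conjTranspose_self G
  have h1 : (sh G)ᴴ * (pw (G * Gᴴ) 0 ⊗ₖ (1 : Matrix T T ℂ)) = (sh (pw (G * Gᴴ) 0 * G))ᴴ := by
    rw [sh_mul, Matrix.conjTranspose_mul, Matrix.conjTranspose_kronecker, pw_conjTranspose,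
      star_zero, Matrix.conjTranspose_one]
  rw [pw_kron_one hG, Matrix.mul_assoc, h1, pw_zero_mul]

lemma cq_mul_of_isometry (s q : ℝ) {W : Matrix K K ℂ} {G : Matrix K (T × F) ℂ}
    (h : Wᴴ * W * G = G) : cq s q (W * G) = cq s q G := by
  set X := G * Gᴴ with hX
  have hXp : X.PosSemidef := Matrix.posSemidef_self_mul_conjTranspose G
  have hWX : (W * G) * (W * G)ᴴ * W = W * X := by
    have h1 : Gᴴ * (Wᴴ * W) = Gᴴ := by
      have := congrArg Matrix.conjTranspose h
      simpa [Matrix.conjTranspose_mul, Matrix.mul_assoc] using this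
    rw [Matrix.conjTranspose_mul, hX]
    calc _ = W * G * (Gᴴ * (Wᴴ * W)) := by simp only [Matrix.mul_assoc]
      _ = _ := by rw [h1, Matrix.mul_assoc]
  have h2 := pw_intertwine (Matrix.isHermitian_mul_conjTranspose_self (W * G)) hXp.1 hWX
    (-s / 2 : ℝ)
  set T1 := sh (pw X (-s / 2 : ℝ) * G) with hT1
  have h3 : sh (pw (W * G * (W * G)ᴴ) (-s / 2 : ℝ) * (W * G)) = (W ⊗ₖ (1 : Matrix T T ℂ)) * T1 := by
    rw [← Matrix.mul_assoc, h2, Matrix.mul_assoc, sh_mul]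
  have h4 : Wᴴ * W * (pw X (-s / 2 : ℝ) * G) = pw X (-s / 2 : ℝ) * G := by
    have h5 : pw X (-s / 2 : ℝ) * G = X * pw X ((-s / 2 : ℝ) - 1) * G := by
      rw [pw_mul_self hXp]; congr 2; ring
    rw [h5, hX]
    simp only [← Matrix.mul_assoc]
    rw [h]
  have h6 : ((W ⊗ₖ (1 : Matrix T T ℂ)) * T1)ᴴ * ((W ⊗ₖ (1 : Matrix T T ℂ)) * T1) = T1ᴴ * T1 := by
    rw [Matrix.conjTranspose_mul, Matrix.mul_assoc, ← Matrix.mul_assoc _ (W ⊗ₖ _),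
      Matrix.conjTranspose_kronecker, Matrix.conjTranspose_one, ← Matrix.mul_kronecker_mul,
      Matrix.one_mul, hT1, ← sh_mul, h4]
  rw [cq, cq, h3, trace_pw_swap, h6, ← trace_pw_swap]

end Reshape

section Purification
variable {m n k l : Type*} [Fintype m] [DecidableEq m] [Fintype n] [DecidableEq n]
  [Fintype k] [DecidableEq k] [Fintype l] [DecidableEq l]

lemma Contr.submatrix {C : Matrix m n ℂ} (h : Contr C) (e : k ≃ m) (e' : l ≃ n) :
    Contr (C.submatrix e e') := by
  rw [contr_iff_posSemidef] at h ⊢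
  have : 1 - (C.submatrix e e')ᴴ * C.submatrix e e' = (1 - Cᴴ * C).submatrix e' e' := by
    rw [Matrix.conjTranspose_submatrix, Matrix.submatrix_mul_equiv]
    ext i j; simp [Matrix.one_apply]
  rw [this]
  exact h.submatrix _

/-- A subnormalised vector factors through a normalised one by a contraction. -/
lemma exists_contr_mul [Nonempty n] (Ψ : Matrix m n ℂ) (h : hs Ψ ≤ 1) :
    ∃ (Γ : Matrix m n ℂ) (κ : Matrix n n ℂ), Contr Γ ∧ hs κ = 1 ∧ Γ * κ = Ψ := by
  set c : ℝ := (1 - hs Ψ) / Fintype.card n with hc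
  have hcard : (Fintype.card n : ℝ) ≠ 0 := by simp
  have hc0 : 0 ≤ c := div_nonneg (by linarith) (by positivity)
  set y : Matrix (m ⊕ n) n ℂ := Matrix.fromRows Ψ ((√c : ℂ) • (1 : Matrix n n ℂ)) with hy
  set Sel : Matrix m (m ⊕ n) ℂ := Matrix.fromCols 1 0 with hSel
  have hSelC : Contr Sel := by
    apply contr_of_self_mul_conjTranspose
    have : Sel * Selᴴ = 1 := by
      rw [hSel, Matrix.conjTranspose_fromCols_eq_fromRows_conjTranspose,
        Matrix.fromCols_mul_fromRows]
      simp
    rw [this]; exact contr_one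
  have hSely : Sel * y = Ψ := by rw [hSel, hy, Matrix.fromCols_mul_fromRows]; simp
  have hyp := Matrix.posSemidef_conjTranspose_mul_self y
  refine ⟨Sel * (y * pw (yᴴ * y) (-1 / 2 : ℝ)), pw (yᴴ * y) (1 / 2 : ℝ), ?_, ?_, ?_⟩
  · refine hSelC.mul ?_
    have := contr_polar y
    rw [pw, spec_swap]
    exact this
  · have h1 : (hs (pw (yᴴ * y) (1 / 2 : ℝ)) : ℂ) = 1 := by
      rw [hs_pw_half hyp 1, Complex.ofReal_one, pw_one hyp, trace_conjTranspose_mul_eq_hs]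
      have : hs y = hs Ψ + c * Fintype.card n := by
        simp only [hs, hy, Fintype.sum_sum_type, Matrix.fromRows_apply_inl,
          Matrix.fromRows_apply_inr]
        congr 1
        have hi : ∀ x x' : n, ‖((√c : ℂ) • (1 : Matrix n n ℂ)) x x'‖ ^ 2
            = if x = x' then c else 0 := by
          intro x x'
          rw [Matrix.smul_apply, Matrix.one_apply]
          split_ifs <;> simp [Real.sq_sqrt hc0]
        simp_rw [hi]
        simp [mul_comm]
      rw [this, hc, div_mul_cancel₀ _ hcard]; norm_num
    exact_mod_cast h1
  · rw [Matrix.mul_assoc, Matrix.mul_assoc, pw_mul hyp.1,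
      pw_congr_arg (v := 0) (by push_cast; ring), mul_pw_zero, hSely]

end Purification

section Families
variable {S R E S' E' F P I K' Q : Type*} [Fintype S] [DecidableEq S] [Fintype R] [DecidableEq R]
  [Fintype E] [DecidableEq E] [Fintype S'] [DecidableEq S'] [Fintype E'] [DecidableEq E']
  [Fintype F] [DecidableEq F] [Fintype P] [DecidableEq P] [Fintype I] [DecidableEq I]
  [Fintype K'] [DecidableEq K'] [Fintype Q] [DecidableEq Q]

/-- Kraus operators `A` applied to half of a vector `κ` on `I × I`. -/
def GI (A : Matrix (E' × (S' × F)) I ℂ) (κ : Matrix I I ℂ) : Matrix (I × E') (S' × F) ℂ :=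
  Matrix.of fun a b => ∑ i, A (a.2, b) i * κ a.1 i

/-- Kraus operators `A` applied to a vector `Ψ` on `S E R P`, where `I` is identified with
`R × E` by `ε`. -/
def GG (A : Matrix (E' × (S' × F)) I ℂ) (ε : I ≃ R × E) (Ψ : Matrix (S × E) (R × P) ℂ) :
    Matrix (S × E') (S' × (F × P)) ℂ :=
  Matrix.of fun a b => ∑ i, A (a.2, (b.1, b.2.1)) i * Ψ (a.1, (ε i).2) ((ε i).1, b.2.2)

lemma cq_GG_le [Nonempty I] (A : Matrix (E' × (S' × F)) I ℂ) (ε : I ≃ R × E)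
    {s q Kq : ℝ} (hs0 : 0 < s) (hs1 : s < 1) (hq : q = 1 / (1 - s))
    (hK : ∀ κ : Matrix I I ℂ, hs κ = 1 → cq s q (GI A κ) ≤ Kq)
    (Ψ : Matrix (S × E) (R × P) ℂ) (hΨ : hs Ψ ≤ 1) : cq s q (GG A ε Ψ) ≤ Kq := by
  set Ψ' : Matrix (S × P) I ℂ := Matrix.of fun a i => Ψ (a.1, (ε i).2) ((ε i).1, a.2) with hΨ'
  have hh : hs Ψ' = hs Ψ := by
    have h1 : ∀ a : S × P, ∑ i, ‖Ψ' a i‖ ^ 2 = ∑ x : R × E, ‖Ψ (a.1, x.2) (x.1, a.2)‖ ^ 2 :=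
      fun a => ε.sum_comp fun x => ‖Ψ (a.1, x.2) (x.1, a.2)‖ ^ 2
    simp only [hs, h1, Fintype.sum_prod_type]
    refine Finset.sum_congr rfl fun t _ => ?_
    rw [Finset.sum_comm' (t' := Finset.univ) (s' := fun _ => Finset.univ) (by simp)]
    rw [Finset.sum_comm (s := (Finset.univ : Finset E))]
    refine Finset.sum_congr rfl fun r _ => ?_
    rw [Finset.sum_comm]
  obtain ⟨Γ, κ, hΓ, hκ, hΓκ⟩ := exists_contr_mul Ψ' (hh.trans_le hΨ)
  refine le_trans ?_ (hK κ hκ)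
  set V : Matrix (((S × E') × S') × P) ((I × E') × S') ℂ :=
    Matrix.of fun a b => Γ (a.1.1.1, a.2) b.1.1 * (if a.1.1.2 = b.1.2 then 1 else 0) *
      (if a.1.2 = b.2 then 1 else 0) with hV
  have hVC : Contr V := by
    have h1 := (hΓ.kron_one (k := E' × S')).submatrix
      (⟨fun a => ((a.1.1.1, a.2), (a.1.1.2, a.1.2)), fun b => (((b.1.1, b.2.1), b.2.2), b.1.2),
        fun _ => rfl, fun _ => rfl⟩ : ((S × E') × S') × P ≃ (S × P) × (E' × S'))
      (Equiv.prodAssoc I E' S')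
    convert h1 using 1
    ext ⟨⟨⟨t, e⟩, s'⟩, p⟩ ⟨⟨j, e2⟩, s2⟩
    by_cases h1 : e = e2 <;> by_cases h2 : s' = s2 <;> simp [hV, h1, h2]
  have hVW : ∀ (w : (I × E') × S' → ℂ) t e s' p,
      ∑ b, V (((t, e), s'), p) b * w b = ∑ j, Γ (t, p) j * w ((j, e), s') := by
    intro w t e s' p
    simp [hV, Fintype.sum_prod_type]
  set G0 := GI A κ with hG0
  set G := GG A ε Ψ with hG
  have key : ∀ t e s' f p, ∑ j, Γ (t, p) j * G0 (j, e) (s', f) = G (t, e) (s', (f, p)) := by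
    intro t e s' f p
    simp only [hG0, hG, GI, GG, Matrix.of_apply, Finset.mul_sum]
    rw [Finset.sum_comm]
    refine Finset.sum_congr rfl fun i _ => ?_
    have := congrFun (congrFun hΓκ (t, p)) i
    rw [hΨ', Matrix.mul_apply, Matrix.of_apply] at this
    rw [← this, Finset.mul_sum]
    exact Finset.sum_congr rfl fun _ _ => by ring
  have hV1 : ∀ t e s' p f, (V * sh G0) (((t, e), s'), p) f = G (t, e) (s', (f, p)) := by
    intro t e s' p f
    rw [Matrix.mul_apply, hVW fun b => sh G0 b f]
    exact key t e s' f p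
  have hV2 : ∀ t e s' p b s2, (V * (G0 ⊗ₖ (1 : Matrix S' S' ℂ))) (((t, e), s'), p) (b, s2)
      = G (t, e) (b.1, (b.2, p)) * (1 : Matrix S' S' ℂ) s' s2 := by
    intro t e s' p b s2
    rw [Matrix.mul_apply, hVW fun c => (G0 ⊗ₖ (1 : Matrix S' S' ℂ)) c (b, s2), ← key]
    rw [Finset.sum_mul]
    exact Finset.sum_congr rfl fun _ _ => (mul_assoc _ _ _).symm
  have hN : ptB (V * (sh G0 * (sh G0)ᴴ) * Vᴴ) = sh G * (sh G)ᴴ := by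
    have : V * (sh G0 * (sh G0)ᴴ) * Vᴴ = (V * sh G0) * (V * sh G0)ᴴ := by
      rw [Matrix.conjTranspose_mul]; simp only [Matrix.mul_assoc]
    rw [this]
    ext ⟨⟨t, e⟩, s'⟩ ⟨⟨t2, e2⟩, s2⟩
    simp only [ptB, Matrix.of_apply, Matrix.mul_apply (M := V * sh G0),
      Matrix.mul_apply (M := sh G), Matrix.conjTranspose_apply, hV1]
    simp only [sh, Matrix.of_apply, Fintype.sum_prod_type]
    rw [Finset.sum_comm]
  have hX : ptB (V * ((G0 * G0ᴴ) ⊗ₖ (1 : Matrix S' S' ℂ)) * Vᴴ)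
      = (G * Gᴴ) ⊗ₖ (1 : Matrix S' S' ℂ) := by
    have : V * ((G0 * G0ᴴ) ⊗ₖ (1 : Matrix S' S' ℂ)) * Vᴴ
        = (V * (G0 ⊗ₖ (1 : Matrix S' S' ℂ))) * (V * (G0 ⊗ₖ (1 : Matrix S' S' ℂ)))ᴴ := by
      have : (G0 * G0ᴴ) ⊗ₖ (1 : Matrix S' S' ℂ)
          = (G0 ⊗ₖ (1 : Matrix S' S' ℂ)) * (G0 ⊗ₖ (1 : Matrix S' S' ℂ))ᴴ := by
        rw [Matrix.conjTranspose_kronecker, Matrix.conjTranspose_one, ← Matrix.mul_kronecker_mul,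
          Matrix.mul_one]
      rw [this, Matrix.conjTranspose_mul]; simp only [Matrix.mul_assoc]
    rw [this]
    generalize hVG : V * (G0 ⊗ₖ (1 : Matrix S' S' ℂ)) = VG at hV2
    ext ⟨⟨t, e⟩, s'⟩ ⟨⟨t2, e2⟩, s2⟩
    simp only [ptB, Matrix.of_apply, Matrix.mul_apply, Matrix.kroneckerMap_apply,
      Matrix.conjTranspose_apply, Fintype.sum_prod_type, hV2, star_mul']
    have h1 : ∀ a b : ℂ, ∀ x : S', a * (1 : Matrix S' S' ℂ) s' x * (b * star ((1 : Matrix S' S' ℂ) s2 x))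
        = if s' = x then (a * b * (1 : Matrix S' S' ℂ) s' s2) else 0 := by
      intro a b x
      by_cases h : s' = x
      · subst h; by_cases h' : s2 = s' <;> simp [Matrix.one_apply, h', Ne.symm]
      · simp [Matrix.one_apply, h]
    simp only [h1, Finset.sum_ite_eq, Finset.mem_univ, if_true, ← Finset.sum_mul]
    congr 1
    rw [Finset.sum_comm]
    refine Finset.sum_congr rfl fun x _ => ?_
    rw [Finset.sum_comm]
  rw [cq_eq_sandw, cq_eq_sandw, ← hN, ← hX]
  exact trace_sandw_ptB_le hVC
    ((Matrix.posSemidef_self_mul_conjTranspose _).kronecker Matrix.PosSemidef.one)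
    (Matrix.posSemidef_self_mul_conjTranspose _) (sh_mul_conjTranspose_supp _) hs0 hs1 hq

/-- Kraus operators `B` applied to the register `E` of a vector on `S E Q`. -/
def GB (B : Matrix (E' × K') E ℂ) (Ψ : Matrix (S × E) Q ℂ) : Matrix (S × E') (K' × Q) ℂ :=
  Matrix.of fun a b => ∑ e, B (a.2, b.1) e * Ψ (a.1, e) b.2

lemma sum_sesquilinear {β ι : Type*} [Fintype β] [Fintype ι] (u v : β → ι → ℂ) (w z : ι → ℂ) :
    ∑ b, (∑ x, u b x * w x) * star (∑ y, v b y * z y)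
      = ∑ x, ∑ y, w x * star (z y) * ∑ b, u b x * star (v b y) := by
  simp only [star_sum, Finset.sum_mul_sum]
  simp only [star_mul', Finset.mul_sum]
  rw [Finset.sum_comm]
  refine Finset.sum_congr rfl fun x _ => ?_
  rw [Finset.sum_comm]
  exact Finset.sum_congr rfl fun y _ => Finset.sum_congr rfl fun b _ => by ring

lemma GG_mul_conjTranspose (A : Matrix (E' × (S' × F)) I ℂ) (ε : I ≃ R × E)
    (B : Matrix (E' × K') E ℂ)
    (hNS : ∀ e e' i j, ∑ b, A (e, b) i * star (A (e', b) j)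
      = if (ε i).1 = (ε j).1 then ∑ k, B (e, k) (ε i).2 * star (B (e', k) (ε j).2) else 0)
    (Ψ : Matrix (S × E) (R × P) ℂ) :
    GG A ε Ψ * (GG A ε Ψ)ᴴ = GB B Ψ * (GB B Ψ)ᴴ := by
  ext ⟨t, e⟩ ⟨t', e'⟩
  have h1 : (GG A ε Ψ * (GG A ε Ψ)ᴴ) (t, e) (t', e') = ∑ p, ∑ b : S' × F,
      (∑ i, A (e, b) i * Ψ (t, (ε i).2) ((ε i).1, p)) *
        star (∑ i, A (e', b) i * Ψ (t', (ε i).2) ((ε i).1, p)) := by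
    simp only [Matrix.mul_apply, Matrix.conjTranspose_apply, GG, Matrix.of_apply,
      Fintype.sum_prod_type]
    rw [Finset.sum_comm (s := (Finset.univ : Finset P))]
    refine Finset.sum_congr rfl fun s _ => ?_
    rw [Finset.sum_comm]
  have h2 : (GB B Ψ * (GB B Ψ)ᴴ) (t, e) (t', e') = ∑ q : R × P, ∑ k,
      (∑ x, B (e, k) x * Ψ (t, x) q) * star (∑ x, B (e', k) x * Ψ (t', x) q) := by
    simp only [Matrix.mul_apply, Matrix.conjTranspose_apply, GB, Matrix.of_apply]
    rw [Fintype.sum_prod_type, Finset.sum_comm]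
  rw [h1, h2, Fintype.sum_prod_type, Finset.sum_comm (s := (Finset.univ : Finset R))]
  refine Finset.sum_congr rfl fun p _ => ?_
  simp only [sum_sesquilinear, hNS]
  rw [ε.sum_comp fun x => ∑ j, Ψ (t, x.2) (x.1, p) * star (Ψ (t', (ε j).2) ((ε j).1, p)) *
    if x.1 = (ε j).1 then ∑ k, B (e, k) x.2 * star (B (e', k) (ε j).2) else 0,
    Fintype.sum_prod_type]
  refine Finset.sum_congr rfl fun r _ => Finset.sum_congr rfl fun x _ => ?_
  rw [ε.sum_comp fun y => Ψ (t, x) (r, p) * star (Ψ (t', y.2) (y.1, p)) *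
    if r = y.1 then ∑ k, B (e, k) x * star (B (e', k) y.2) else 0, Fintype.sum_prod_type,
    Finset.sum_comm]
  exact Finset.sum_congr rfl fun y _ => by simp

lemma GB_mul {Q' : Type*} [Fintype Q'] (B : Matrix (E' × K') E ℂ) (L : Matrix (S × E) Q ℂ)
    (v : Matrix Q Q' ℂ) : GB B (L * v) = GB B L * ((1 : Matrix K' K' ℂ) ⊗ₖ v) := by
  ext a ⟨k, b⟩
  simp only [GB, Matrix.of_apply, Matrix.mul_apply, Finset.mul_sum, Finset.sum_mul,
    Fintype.sum_prod_type, Matrix.kroneckerMap_apply, Matrix.one_apply]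
  rw [Finset.sum_comm]
  simp [mul_assoc]

lemma GB_one_kron_apply (B : Matrix (E' × K') E ℂ) (C : Matrix E E ℂ) (t : S) (e : E') (k : K')
    (t' : S) (x : E) : GB B ((1 : Matrix S S ℂ) ⊗ₖ C) (t, e) (k, (t', x))
      = (1 : Matrix S S ℂ) t t' * (B * C) (e, k) x := by
  simp only [GB, Matrix.of_apply, Matrix.mul_apply, Matrix.kroneckerMap_apply, Finset.mul_sum]
  exact Finset.sum_congr rfl fun _ _ => by ring

lemma GB_one_kron_mul_conjTranspose (B : Matrix (E' × K') E ℂ) (C : Matrix E E ℂ) :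
    GB B ((1 : Matrix S S ℂ) ⊗ₖ C) * (GB B ((1 : Matrix S S ℂ) ⊗ₖ C))ᴴ
      = (1 : Matrix S S ℂ) ⊗ₖ ptB (B * (C * Cᴴ) * Bᴴ) := by
  have h : B * (C * Cᴴ) * Bᴴ = (B * C) * (B * C)ᴴ := by
    rw [Matrix.conjTranspose_mul]; simp only [Matrix.mul_assoc]
  rw [h]
  ext ⟨t, e⟩ ⟨t', e'⟩
  have hG := GB_one_kron_apply (S := S) B C
  generalize B * C = D at hG ⊢
  generalize GB B ((1 : Matrix S S ℂ) ⊗ₖ C) = G at hG ⊢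
  simp only [ptB, Matrix.of_apply, Matrix.kroneckerMap_apply,
    Matrix.mul_apply, Matrix.conjTranspose_apply, Fintype.sum_prod_type,
    hG, star_mul']
  by_cases h : t = t'
  · subst h
    simp [Matrix.one_apply]
  · simp [Matrix.one_apply, h]

lemma hs_GB (B : Matrix (E' × K') E ℂ) (Ψ : Matrix (S × E) Q ℂ) :
    hs (GB B Ψ) = hs (((1 : Matrix S S ℂ) ⊗ₖ B) * Ψ) := by
  simp only [hs, GB, Matrix.of_apply, Matrix.mul_apply, Fintype.sum_prod_type,
    Matrix.kroneckerMap_apply, Matrix.one_apply]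
  simp

lemma hs_eq_of_mul_conjTranspose_eq {m n n' : Type*} [Fintype m] [Fintype n] [Fintype n']
    {G : Matrix m n ℂ} {G' : Matrix m n' ℂ} (h : G * Gᴴ = G' * G'ᴴ) : hs G = hs G' := by
  have := congrArg Matrix.trace h
  rw [trace_mul_conjTranspose_eq_hs, trace_mul_conjTranspose_eq_hs] at this
  exact_mod_cast this

lemma MStrip.GG (A : Matrix (E' × (S' × F)) I ℂ) (ε : I ≃ R × E)
    {Ψ : ℂ → Matrix (S × E) (R × P) ℂ} (h : MStrip Ψ) : MStrip fun z => GG A ε (Ψ z) := by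
  intro a b
  exact StripBdd.sum _ fun i => (StripBdd.const _).mul (h _ _)

end Families

section Core
variable {S R E S' E' F P I K' Q : Type*} [Fintype S] [DecidableEq S] [Fintype R] [DecidableEq R]
  [Fintype E] [DecidableEq E] [Fintype S'] [DecidableEq S'] [Fintype E'] [DecidableEq E']
  [Fintype F] [DecidableEq F] [Fintype P] [DecidableEq P] [Fintype I] [DecidableEq I]
  [Fintype K'] [DecidableEq K'] [Fintype Q] [DecidableEq Q]

lemma pw_smul_of_pos {A : Matrix P P ℂ} (h : A.IsHermitian) {c : ℝ} (hc : 0 < c) (p : ℝ) :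
    pw ((c : ℂ) • A) p = ((c ^ p : ℝ) : ℂ) • pw A p := by
  have h1 : pw ((c : ℂ) • A) p = spec A fun x => ((c ^ p : ℝ) : ℂ) * cp p x := by
    rw [pw, spec_smul h]
    congr 1
    ext x
    unfold cp
    by_cases hx : x = 0
    · simp [hx]
    · rw [if_neg (mul_ne_zero hc.ne' hx), if_neg hx, Real.log_mul hc.ne' hx,
        Real.rpow_def_of_pos hc]
      push_cast
      rw [← Complex.exp_add]
      congr 1; ring
  rw [h1, ← spec_mul h, spec_const h, Matrix.smul_mul, Matrix.one_mul]; rfl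

lemma eq_zero_of_trace_pw_eq_zero {A : Matrix P P ℂ} (h : A.PosSemidef) {p : ℝ}
    (h0 : (pw A p).trace.re = 0) : A = 0 := by
  have h1 : hs (pw A (p / 2 : ℝ)) = 0 := by
    have := hs_pw_half h p
    rw [trace_pw_eq_re h.1, h0] at this
    exact_mod_cast this
  have h2 : pw A (p / 2 : ℝ) = 0 := by
    have := trace_mul_conjTranspose_eq_hs (pw A (p / 2 : ℝ))
    rw [h1, Complex.ofReal_zero, Matrix.trace_mul_conjTranspose_self_eq_zero_iff] at this
    exact this
  rw [← pw_one h, pw_add' h.1 (u := (p / 2 : ℝ)) (v := 1 - (p / 2 : ℝ)) (by ring), h2,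
    Matrix.zero_mul]

lemma trace_pw_pos {A : Matrix P P ℂ} (h : A.PosSemidef) (hA : A ≠ 0) (p : ℝ) :
    0 < (pw A p).trace.re :=
  lt_of_le_of_ne (trace_pw_re_nonneg h.1 p) fun h0 => hA (eq_zero_of_trace_pw_eq_zero h h0.symm)

/-- The hypotheses of the chain rule at the level of Kraus operators: `B` is a Kraus operator of
the induced map on the register `E`, `σ'` is the image of `σ`. -/
structure KrausData (A : Matrix (E' × (S' × F)) I ℂ) (ε : I ≃ R × E)
    (B : Matrix (E' × K') E ℂ) (σ : Matrix E E ℂ) (σ' : Matrix E' E' ℂ) : Prop where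
  contr : Contr B
  nonsignalling : ∀ e e' i j, ∑ b, A (e, b) i * star (A (e', b) j)
      = if (ε i).1 = (ε j).1 then ∑ k, B (e, k) (ε i).2 * star (B (e', k) (ε j).2) else 0
  posSemidef : σ.PosSemidef
  map_eq : σ' = ptB (B * σ * Bᴴ)

namespace KrausData
variable {A : Matrix (E' × (S' × F)) I ℂ} {ε : I ≃ R × E} {B : Matrix (E' × K') E ℂ}
  {σ : Matrix E E ℂ} {σ' : Matrix E' E' ℂ}

lemma hs_GG_le (hk : KrausData A ε B σ σ') (Ψ : Matrix (S × E) (R × P) ℂ) :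
    hs (GG A ε Ψ) ≤ hs Ψ := by
  rw [hs_eq_of_mul_conjTranspose_eq (GG_mul_conjTranspose A ε B hk.nonsignalling Ψ), hs_GB]
  exact hs_contr_mul hk.contr.one_kron _

lemma posSemidef' (hk : KrausData A ε B σ σ') : σ'.PosSemidef := by
  rw [hk.map_eq]; exact ptB_posSemidef (hk.posSemidef.mul_mul_conjTranspose_same B)

lemma GB_sqrt (hk : KrausData A ε B σ σ') :
    GB B ((1 : Matrix S S ℂ) ⊗ₖ pw σ (1 / 2 : ℝ)) * (GB B ((1 : Matrix S S ℂ) ⊗ₖ pw σ (1 / 2 : ℝ)))ᴴ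
      = (1 : Matrix S S ℂ) ⊗ₖ σ' := by
  rw [GB_one_kron_mul_conjTranspose, (pw_real_isHermitian _ _).eq, pw_mul hk.posSemidef.1,
    pw_congr_arg (v := 1) (by push_cast; ring), pw_one hk.posSemidef, hk.map_eq]

lemma supp_GG (hk : KrausData A ε B σ σ') {Ψ : Matrix (S × E) (R × P) ℂ}
    (hΨ : ((1 : Matrix S S ℂ) ⊗ₖ pw σ 0) * Ψ = Ψ) :
    ((1 : Matrix S S ℂ) ⊗ₖ pw σ' 0) * GG A ε Ψ = GG A ε Ψ := by
  have h1 := pw_zero_mul (GB B ((1 : Matrix S S ℂ) ⊗ₖ pw σ (1 / 2 : ℝ)))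
  rw [hk.GB_sqrt, pw_one_kron hk.posSemidef'.1] at h1
  have h2 : Ψ = ((1 : Matrix S S ℂ) ⊗ₖ pw σ (1 / 2 : ℝ)) *
      (((1 : Matrix S S ℂ) ⊗ₖ pw σ (-1 / 2 : ℝ)) * Ψ) := by
    rw [← Matrix.mul_assoc, one_kron_mul, pw_mul hk.posSemidef.1,
      pw_congr_arg (v := 0) (by push_cast; ring), hΨ]
  have h3 : ((1 : Matrix S S ℂ) ⊗ₖ pw σ' 0) * GB B Ψ = GB B Ψ := by
    rw [h2, GB_mul, ← Matrix.mul_assoc, h1]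
  set D : Matrix (S × E') (S × E') ℂ := (1 : Matrix S S ℂ) ⊗ₖ pw σ' 0 with hD
  have h4 : ((1 - D) * GG A ε Ψ) * ((1 - D) * GG A ε Ψ)ᴴ = 0 := by
    have h5 : (1 - D) * GB B Ψ = 0 := by rw [Matrix.sub_mul, Matrix.one_mul, h3, sub_self]
    rw [Matrix.conjTranspose_mul, Matrix.mul_assoc, ← Matrix.mul_assoc (GG A ε Ψ),
      GG_mul_conjTranspose A ε B hk.nonsignalling Ψ, ← Matrix.mul_assoc, ← Matrix.mul_assoc, h5,
      Matrix.zero_mul, Matrix.zero_mul]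
  rw [Matrix.self_mul_conjTranspose_eq_zero, Matrix.sub_mul, Matrix.one_mul, sub_eq_zero] at h4
  exact h4.symm

lemma contr_GG (hk : KrausData A ε B σ σ') {v : Matrix (S × E) (R × P) ℂ} (hv : Contr v) :
    Contr (((1 : Matrix S S ℂ) ⊗ₖ pw σ' (-1 / 2 : ℝ)) *
      GG A ε (((1 : Matrix S S ℂ) ⊗ₖ pw σ (1 / 2 : ℝ)) * v)) := by
  have h1 := contr_polar (GB B ((1 : Matrix S S ℂ) ⊗ₖ pw σ (1 / 2 : ℝ)))
  rw [hk.GB_sqrt, pw_one_kron hk.posSemidef'.1] at h1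
  have h2 := h1.mul (hv.one_kron (k := K'))
  rw [Matrix.mul_assoc, ← GB_mul] at h2
  apply contr_of_self_mul_conjTranspose
  have h3 := h2.mul h2.conjTranspose
  rw [Matrix.conjTranspose_mul, Matrix.mul_assoc, ← Matrix.mul_assoc (GB B _),
    ← GG_mul_conjTranspose A ε B hk.nonsignalling] at h3
  rw [Matrix.conjTranspose_mul, Matrix.mul_assoc, ← Matrix.mul_assoc (GG A ε _)]
  exact h3

end KrausData
end Core

section Interpolation
variable {K T F P : Type*} [Fintype K] [DecidableEq K] [Fintype T] [DecidableEq T]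
  [Fintype F] [DecidableEq F] [Fintype P] [DecidableEq P]

lemma re_zero_pw_isometry {A : Matrix P P ℂ} (h : A.IsHermitian) {w : ℂ} (hw : w.re = 0) :
    (pw A w)ᴴ * pw A w = pw A 0 := by
  rw [pw_conjTranspose, pw_mul h]
  congr 1
  apply Complex.ext <;> simp [hw]

/-- Hölder estimate for the boundary of the strip on which the operator is normalised in
Hilbert–Schmidt norm. -/
lemma norm_trace_holder {G : Matrix K (T × F) ℂ} (hG : hs G ≤ 1) {Ω : Matrix K K ℂ}
    (hΩ : Ω.PosSemidef) {Z : Matrix F F ℂ} (hZ : Z.PosSemidef) {u : Matrix K (T × F) ℂ}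
    (hu : Contr u) {Ωi : Matrix K K ℂ} (hΩi : Contr Ωi) {Zi : Matrix F F ℂ} (hZi : Contr Zi)
    {s p q : ℝ} (hs0 : 0 < s) (hs1 : s < 1) (hq : q = 1 / (1 - s)) {Q : ℝ}
    (hΩQ : Ω.trace.re = Q) (hZQ : (pw Z p).trace.re = Q) {Kq : ℝ} (hKq : cq s q G ≤ Kq) :
    ‖(uᴴ * (Ωi * pw Ω ((1 - s) / 2 : ℝ)) * G *
        ((1 : Matrix T T ℂ) ⊗ₖ (pw Z (p * s / 2 : ℝ) * Zi))).trace‖ ≤ √(Q * Kq ^ (1 - s)) := by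
  set X := G * Gᴴ with hX
  have hXp : X.PosSemidef := Matrix.posSemidef_self_mul_conjTranspose G
  set T2 := sh (pw X (-s / 2 : ℝ) * G) with hT2
  set Y := T2 * T2ᴴ with hY
  have hYp : Y.PosSemidef := Matrix.posSemidef_self_mul_conjTranspose T2
  have hQ : 0 ≤ Q := hΩQ ▸ (Complex.le_def.mp hΩ.trace_nonneg).1
  have hsplit : uᴴ * (Ωi * pw Ω ((1 - s) / 2 : ℝ)) * G *
        ((1 : Matrix T T ℂ) ⊗ₖ (pw Z (p * s / 2 : ℝ) * Zi))
      = (uᴴ * (Ωi * (pw Ω ((1 - s) / 2 : ℝ) * pw X (s / 2 : ℝ)))) *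
        ((pw X (-s / 2 : ℝ) * G) * ((1 : Matrix T T ℂ) ⊗ₖ (pw Z (p * s / 2 : ℝ) * Zi))) := by
    have h1 : pw X (s / 2 : ℝ) * (pw X (-s / 2 : ℝ) * G) = G := by
      rw [← Matrix.mul_assoc, pw_mul hXp.1, pw_congr_arg (v := 0) (by push_cast; ring),
        pw_zero_mul]
    simp only [Matrix.mul_assoc]
    rw [← Matrix.mul_assoc (pw X (-s / 2 : ℝ)) G, ← Matrix.mul_assoc (pw X (s / 2 : ℝ)), h1]
  have hA : hs (uᴴ * (Ωi * (pw Ω ((1 - s) / 2 : ℝ) * pw X (s / 2 : ℝ)))) ≤ Q ^ (1 - s) := by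
    refine (hs_contr_mul hu.conjTranspose _).trans ((hs_contr_mul hΩi _).trans ?_)
    have := hs_holder hΩ hXp (contr_one (m := K)) (s := 1 - s) (a := 1) (b := 1) (by linarith)
      (by linarith)
    rw [Matrix.mul_one] at this
    have e1 : (1 - s) * 1 / 2 = (1 - s) / 2 := by ring
    have e2 : (1 - (1 - s)) * 1 / 2 = s / 2 := by ring
    have e3 : 1 - (1 - s) = s := by ring
    rw [e1, e2, e3, Complex.ofReal_one, pw_one hΩ, pw_one hXp, hΩQ, hX,
      trace_mul_conjTranspose_eq_hs, Complex.ofReal_re] at this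
    refine this.trans ?_
    have := Real.rpow_le_one (hs_nonneg G) hG hs0.le
    exact mul_le_of_le_one_right (Real.rpow_nonneg hQ _) this
  have hB : hs ((pw X (-s / 2 : ℝ) * G) * ((1 : Matrix T T ℂ) ⊗ₖ (pw Z (p * s / 2 : ℝ) * Zi)))
      ≤ Kq ^ (1 - s) * Q ^ s := by
    rw [← hs_sh, sh_mul_one_kron, ← hT2, ← Matrix.mul_assoc]
    refine (hs_mul_contr hZi _).trans ?_
    have h1 : T2 = pw Y (1 / 2 : ℝ) * (pw Y (-1 / 2 : ℝ) * T2) := by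
      rw [← Matrix.mul_assoc, pw_mul hYp.1, pw_congr_arg (v := 0) (by push_cast; ring),
        pw_zero_mul]
    have := hs_holder hYp hZ (contr_polar T2) (s := 1 - s) (a := q) (b := p) (by linarith)
      (by linarith)
    have e1 : (1 - s) * q / 2 = 1 / 2 := by
      rw [hq]; field_simp [show (1 - s) ≠ 0 by linarith]
    have e2 : (1 - (1 - s)) * p / 2 = p * s / 2 := by ring
    have e3 : 1 - (1 - s) = s := by ring
    rw [← hY, e1, e2, e3, hZQ, ← h1] at this
    refine this.trans ?_
    have h2 : (pw Y q).trace.re = cq s q G := rfl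
    rw [h2]
    gcongr
    exact cq_nonneg s q G
  have hKq0 : 0 ≤ Kq := (cq_nonneg s q G).trans hKq
  rw [hsplit]
  refine (norm_trace_mul_le _ _).trans ?_
  rw [← Real.sqrt_mul (hs_nonneg _)]
  apply Real.sqrt_le_sqrt
  calc _ ≤ Q ^ (1 - s) * (Kq ^ (1 - s) * Q ^ s) :=
        mul_le_mul hA hB (hs_nonneg _) (Real.rpow_nonneg hQ _)
    _ = (Q ^ (1 - s) * Q ^ s) * Kq ^ (1 - s) := by ring
    _ = Q * Kq ^ (1 - s) := by
      rw [← Real.rpow_add_of_nonneg hQ (by linarith) hs0.le]; simp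

/-- Interpolation bound: a family that is a contraction on `re z = 1`, normalised with bounded
conditional quantity on `re z = 0`. -/
lemma trace_pw_le_of_family {G : ℂ → Matrix K (T × F) ℂ} (hst : MStrip G)
    {s p q θ : ℝ} (hs0 : 0 < s) (hs1 : s < 1) (hq : q = 1 / (1 - s)) (hp : p = 1 + s)
    (hθ : θ = s / (1 + s)) {Kq : ℝ}
    (h0 : ∀ z : ℂ, z.re = 0 → hs (G z) ≤ 1 ∧ cq s q (G z) ≤ Kq)
    (h1 : ∀ z : ℂ, z.re = 1 → Contr (G z)) :
    (pw (sh (G θ) * (sh (G θ))ᴴ) p).trace.re ≤ Kq ^ (1 - s) := by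
  have hθ0 : 0 ≤ θ := by rw [hθ]; positivity
  have hθ1 : θ < 1 := by rw [hθ, div_lt_one (by linarith)]; linarith
  have hθs : (1 + s) * θ = s := by rw [hθ]; field_simp
  have hθsC : (1 + s : ℂ) * θ = s := by exact_mod_cast hθs
  have hpC : (p : ℂ) = 1 + s := by rw [hp]; push_cast; ring
  have hKq0 : 0 ≤ Kq := (cq_nonneg s q _).trans (h0 0 rfl).2
  set Z := (sh (G θ))ᴴ * sh (G θ) with hZ
  have hZp : Z.PosSemidef := Matrix.posSemidef_conjTranspose_mul_self _
  rw [trace_pw_swap, ← hZ]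
  set Q := (pw Z p).trace.re with hQ
  have hQ0 : 0 ≤ Q := trace_pw_re_nonneg hZp.1 p
  set ζ := G θ * ((1 : Matrix T T ℂ) ⊗ₖ pw Z (s / 2 : ℝ)) with hζ
  have hζQ : hs ζ = Q := by
    have : (hs ζ : ℂ) = (pw Z p).trace := by
      rw [hζ, ← hs_sh, sh_mul_one_kron, ← trace_conjTranspose_mul_eq_hs, Matrix.conjTranspose_mul,
        (pw_real_isHermitian _ _).eq, Matrix.mul_assoc, ← Matrix.mul_assoc _ (sh (G θ)), ← hZ,
        pw_mul_self hZp, pw_mul hZp.1]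
      congr 2
      rw [hpC]; push_cast; ring
    rw [hQ, ← this, Complex.ofReal_re]
  set Ω := ζ * ζᴴ with hΩ
  have hΩp : Ω.PosSemidef := Matrix.posSemidef_self_mul_conjTranspose _
  have hΩQ : Ω.trace.re = Q := by
    rw [hΩ, trace_mul_conjTranspose_eq_hs, hζQ, Complex.ofReal_re]
  set u := pw Ω (-1 / 2 : ℝ) * ζ with hu
  have huC : Contr u := contr_polar ζ
  set f : ℂ → ℂ := fun z => (uᴴ * pw Ω (((1 + s) / 2 : ℝ) * z + ((1 - s) / 2 : ℝ)) * G z *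
    ((1 : Matrix T T ℂ) ⊗ₖ pw Z ((-(p * s) / 2 : ℝ) * z + (p * s / 2 : ℝ)))).trace with hf
  have hfst : StripBdd f :=
    ((((MStrip.const _).mul (MStrip.pw hΩp.1 _ _)).mul hst).mul
      (MStrip.pw hZp.1 _ _).one_kron).trace
  have hfθ : f θ = Q := by
    rw [hf]
    simp only
    have a1 : (((1 + s) / 2 : ℝ) : ℂ) * θ + ((1 - s) / 2 : ℝ) = (1 / 2 : ℝ) := by
      push_cast; linear_combination (1 / 2 : ℂ) * hθsC
    have a2 : ((-(p * s) / 2 : ℝ) : ℂ) * θ + (p * s / 2 : ℝ) = (s / 2 : ℝ) := by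
      push_cast; rw [hpC]; linear_combination (-(s : ℂ) / 2) * hθsC
    rw [a1, a2, Matrix.mul_assoc _ (G θ), ← hζ, hu, Matrix.conjTranspose_mul,
      (pw_real_isHermitian _ _).eq, Matrix.mul_assoc ζᴴ, pw_mul hΩp.1,
      pw_congr_arg (v := 0) (by push_cast; ring), Matrix.mul_assoc, hΩ, pw_zero_mul,
      trace_conjTranspose_mul_eq_hs, hζQ]
  have hb0 : ∀ z : ℂ, z.re = 0 → ‖f z‖ ≤ √(Q * Kq ^ (1 - s)) := by
    intro z hz
    rw [hf]
    simp only
    rw [pw_add' hΩp.1 (w := ((1 + s) / 2 : ℝ) * z + ((1 - s) / 2 : ℝ)) rfl,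
      pw_add' hZp.1 (u := (p * s / 2 : ℝ)) (v := (-(p * s) / 2 : ℝ) * z) (by ring)]
    exact norm_trace_holder (h0 z hz).1 hΩp hZp huC (contr_pw_im hΩp.1 (by simp [hz]))
      (contr_pw_im hZp.1 (by simp [hz])) hs0 hs1 hq hΩQ rfl (h0 z hz).2
  have hb1 : ∀ z : ℂ, z.re = 1 → ‖f z‖ ≤ Q := by
    intro z hz
    rw [hf]
    simp only
    rw [pw_add' hΩp.1 (w := ((1 + s) / 2 : ℝ) * z + ((1 - s) / 2 : ℝ)) (u := 1)
      (v := ((1 + s) / 2 : ℝ) * (z - 1)) (by push_cast; ring), pw_one hΩp]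
    rw [Matrix.mul_assoc, Matrix.mul_assoc, Matrix.trace_mul_comm, Matrix.mul_assoc,
      Matrix.mul_assoc, ← hΩQ]
    refine norm_trace_mul_contr_le hΩp ?_
    refine (contr_pw_im hΩp.1 (by simp [hz])).mul (Contr.mul ?_ huC.conjTranspose)
    exact (h1 z hz).mul (contr_pw_im hZp.1 (by simp [hz]; ring)).one_kron
  have h3 := hfst.three_lines hb0 hb1 hθ0 hθ1.le
  rw [hfθ, Complex.norm_real, Real.norm_of_nonneg hQ0] at h3
  have h4 := le_of_le_rpow_mul_rpow hQ0 (Real.sqrt_nonneg _) hθ1 h3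
  have hk : 0 ≤ Kq ^ (1 - s) := Real.rpow_nonneg hKq0 _
  have h5 := Real.sq_sqrt (mul_nonneg hQ0 hk)
  by_contra hcon
  push Not at hcon
  nlinarith

end Interpolation

section CoreBound
variable {S R E S' E' F P I K' Q : Type*} [Fintype S] [DecidableEq S] [Fintype R] [DecidableEq R]
  [Fintype E] [DecidableEq E] [Fintype S'] [DecidableEq S'] [Fintype E'] [DecidableEq E']
  [Fintype F] [DecidableEq F] [Fintype P] [DecidableEq P] [Fintype I] [DecidableEq I]
  [Fintype K'] [DecidableEq K']

lemma GG_smul (A : Matrix (E' × (S' × F)) I ℂ) (ε : I ≃ R × E) (c : ℂ)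
    (Ψ : Matrix (S × E) (R × P) ℂ) : GG A ε (c • Ψ) = c • GG A ε Ψ := by
  ext a b
  simp only [GG, Matrix.of_apply, Matrix.smul_apply, smul_eq_mul, Finset.mul_sum]
  exact Finset.sum_congr rfl fun _ _ => by ring

lemma hs_smul {m n : Type*} [Fintype m] [Fintype n] (c : ℂ) (X : Matrix m n ℂ) :
    hs (c • X) = ‖c‖ ^ 2 * hs X := by
  simp only [hs, Matrix.smul_apply, smul_eq_mul, norm_mul, mul_pow, Finset.mul_sum]

lemma Contr.smul {m n : Type*} [Fintype m] [DecidableEq m] [Fintype n] [DecidableEq n] {c : ℂ}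
    (hc : ‖c‖ ≤ 1) {X : Matrix m n ℂ} (h : Contr X) : Contr (c • X) := by
  open scoped Matrix.Norms.L2Operator in
  exact (norm_smul_le c X).trans (mul_le_one₀ hc (norm_nonneg _) h)

/-- The multiplicative chain rule at the level of Kraus operators. -/
theorem KrausData.chain [Nonempty I] {A : Matrix (E' × (S' × F)) I ℂ} {ε : I ≃ R × E}
    {B : Matrix (E' × K') E ℂ} {σ : Matrix E E ℂ} {σ' : Matrix E' E' ℂ}
    (hk : KrausData A ε B σ σ') {s p q θ : ℝ} (hs0 : 0 < s) (hs1 : s < 1)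
    (hq : q = 1 / (1 - s)) (hp : p = 1 + s) (hθ : θ = s / (1 + s)) {Kq : ℝ}
    (hK : ∀ κ : Matrix I I ℂ, hs κ = 1 → cq s q (GI A κ) ≤ Kq)
    {Ψ : Matrix (S × E) (R × P) ℂ} (hΨ0 : Ψ ≠ 0)
    (hΨ : ((1 : Matrix S S ℂ) ⊗ₖ pw σ 0) * Ψ = Ψ) :
    (pw (sh (((1 : Matrix S S ℂ) ⊗ₖ pw σ' (-θ / 2 : ℝ)) * GG A ε Ψ) *
        (sh (((1 : Matrix S S ℂ) ⊗ₖ pw σ' (-θ / 2 : ℝ)) * GG A ε Ψ))ᴴ) p).trace.re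
      ≤ (pw ((((1 : Matrix S S ℂ) ⊗ₖ pw σ (-θ / 2 : ℝ)) * Ψ) *
        (((1 : Matrix S S ℂ) ⊗ₖ pw σ (-θ / 2 : ℝ)) * Ψ)ᴴ) p).trace.re * Kq ^ (1 - s) := by
  have hσ := hk.posSemidef
  have hσ' := hk.posSemidef'
  set y := ((1 : Matrix S S ℂ) ⊗ₖ pw σ (-θ / 2 : ℝ)) * Ψ with hy
  have hyΨ : ((1 : Matrix S S ℂ) ⊗ₖ pw σ (θ / 2 : ℝ)) * y = Ψ := by
    rw [hy, ← Matrix.mul_assoc, one_kron_mul, pw_mul hσ.1,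
      pw_congr_arg (v := 0) (by push_cast; ring), hΨ]
  set H := y * yᴴ with hH
  have hHp : H.PosSemidef := Matrix.posSemidef_self_mul_conjTranspose y
  set h := (pw H p).trace.re with hh
  have hpos : 0 < h := by
    refine trace_pw_pos hHp (fun h0 => hΨ0 ?_) p
    rw [hH, Matrix.self_mul_conjTranspose_eq_zero] at h0
    rw [← hyΨ, h0, Matrix.mul_zero]
  set u := pw H (-1 / 2 : ℝ) * y with hu
  have huC : Contr u := contr_polar y
  have hHu : pw H (1 / 2 : ℝ) * u = y := by
    rw [hu, ← Matrix.mul_assoc, pw_mul hHp.1, pw_congr_arg (v := 0) (by push_cast; ring),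
      pw_zero_mul]
  set c : ℂ → ℂ := fun z => cp ((1 / 2 : ℝ) * z + (-1 / 2 : ℝ)) h with hc
  have hcn : ∀ z, ‖c z‖ = h ^ ((z.re - 1) / 2) := by
    intro z
    rw [hc, norm_cp, if_neg hpos.ne', Real.rpow_def_of_pos hpos]
    congr 1
    simp; ring
  set v : ℂ → Matrix (S × E) (R × P) ℂ := fun z =>
    pw H ((-p / 2 : ℝ) * z + (p / 2 : ℝ)) * u with hv
  set Φ : ℂ → Matrix (S × E) (R × P) ℂ := fun z =>
    c z • (((1 : Matrix S S ℂ) ⊗ₖ pw σ ((1 / 2 : ℝ) * z + 0)) * v z) with hΦ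
  set G : ℂ → Matrix (S × E') (S' × (F × P)) ℂ := fun z =>
    ((1 : Matrix S S ℂ) ⊗ₖ pw σ' ((-1 / 2 : ℝ) * z + 0)) * GG A ε (Φ z) with hG
  have hΦsupp : ∀ z, ((1 : Matrix S S ℂ) ⊗ₖ pw σ 0) * Φ z = Φ z := by
    intro z
    rw [hΦ]
    simp only
    rw [Matrix.mul_smul, ← Matrix.mul_assoc, one_kron_mul, pw_mul hσ.1, zero_add]
  have hst : MStrip G := by
    refine (MStrip.pw hσ'.1 _ _).one_kron.mul (MStrip.GG A ε ?_)
    exact MStrip.smul (StripBdd.cp _ _ _) ((MStrip.pw hσ.1 _ _).one_kron.mul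
      ((MStrip.pw hHp.1 _ _).mul (MStrip.const _)))
  have hb0 : ∀ z : ℂ, z.re = 0 → hs (G z) ≤ 1 ∧ cq s q (G z) ≤ Kq := by
    intro z hz
    have hΦ1 : hs (Φ z) ≤ 1 := by
      have h1 : hs (((1 : Matrix S S ℂ) ⊗ₖ pw σ ((1 / 2 : ℝ) * z + 0)) * v z) ≤ h := by
        refine (hs_contr_mul (contr_pw_im hσ.1 (by simp [hz])).one_kron _).trans ?_
        refine (hs_mul_contr huC _).trans ?_
        rw [pw_add' hHp.1 (w := (-p / 2 : ℝ) * z + (p / 2 : ℝ)) rfl]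
        refine (hs_contr_mul (contr_pw_im hHp.1 (by simp [hz])) _).trans ?_
        rw [hh, ← hs_pw_half hHp, Complex.ofReal_re]
      rw [hΦ]
      simp only
      rw [hs_smul, hcn, hz, ← Real.rpow_natCast, ← Real.rpow_mul hpos.le]
      calc _ ≤ h ^ ((0 - 1) / 2 * ((2 : ℕ) : ℝ)) * h := by gcongr
        _ = 1 := by
          rw [← Real.rpow_add_one hpos.ne']; norm_num
    have hiso := re_zero_pw_isometry hσ'.1 (w := (-1 / 2 : ℝ) * z + 0) (by simp [hz])
    refine ⟨?_, ?_⟩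
    · exact (hs_contr_mul (contr_pw_im hσ'.1 (by simp [hz])).one_kron _).trans
        ((hk.hs_GG_le _).trans hΦ1)
    · rw [hG]
      simp only
      rw [cq_mul_of_isometry]
      · exact cq_GG_le A ε hs0 hs1 hq hK _ hΦ1
      · rw [one_kron_conjTranspose, one_kron_mul, hiso, hk.supp_GG (hΦsupp z)]
  have hb1 : ∀ z : ℂ, z.re = 1 → Contr (G z) := by
    intro z hz
    have e1 : Φ z = ((1 : Matrix S S ℂ) ⊗ₖ pw σ (1 / 2 : ℝ)) *
        (c z • (((1 : Matrix S S ℂ) ⊗ₖ pw σ ((1 / 2 : ℝ) * (z - 1))) * v z)) := by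
      rw [hΦ]
      simp only
      have e0 : ((1 : Matrix S S ℂ) ⊗ₖ pw σ ((1 / 2 : ℝ) * z + 0))
          = ((1 : Matrix S S ℂ) ⊗ₖ pw σ (1 / 2 : ℝ)) *
            ((1 : Matrix S S ℂ) ⊗ₖ pw σ ((1 / 2 : ℝ) * (z - 1))) := by
        rw [one_kron_mul, ← pw_add' hσ.1]
        push_cast; ring
      rw [e0, Matrix.mul_smul, Matrix.mul_assoc]
    rw [hG]
    simp only
    rw [e1, pw_add' hσ'.1 (w := (-1 / 2 : ℝ) * z + 0) (u := (-1 / 2 : ℝ) * (z - 1))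
      (v := (-1 / 2 : ℝ)) (by push_cast; ring), ← one_kron_mul, Matrix.mul_assoc]
    refine (contr_pw_im hσ'.1 (by simp [hz])).one_kron.mul (hk.contr_GG (Contr.smul ?_ ?_))
    · rw [hcn, hz]; simp
    · exact (contr_pw_im hσ.1 (by simp [hz])).one_kron.mul
        ((contr_pw_im hHp.1 (by simp [hz]; ring)).mul huC)
  have hmain := trace_pw_le_of_family hst hs0 hs1 hq hp hθ hb0 hb1
  have hpθ : p * (1 - θ) = 1 := by rw [hp, hθ]; field_simp; ring
  have hpθC : (p : ℂ) * (1 - θ) = 1 := by exact_mod_cast hpθ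
  have hΦθ : Φ θ = c θ • Ψ := by
    rw [hΦ]
    simp only
    rw [hv]
    simp only
    rw [pw_congr_arg (A := H) (v := (1 / 2 : ℝ))
      (by push_cast; linear_combination (1 / 2 : ℂ) * hpθC), hHu,
      pw_congr_arg (A := σ) (v := (θ / 2 : ℝ)) (by push_cast; ring), hyΨ]
  have hGθ : G θ = c θ • (((1 : Matrix S S ℂ) ⊗ₖ pw σ' (-θ / 2 : ℝ)) * GG A ε Ψ) := by
    rw [hG]
    simp only
    rw [hΦθ, GG_smul, Matrix.mul_smul, pw_congr_arg (A := σ') (v := (-θ / 2 : ℝ))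
      (by push_cast; ring)]
  set G1 := ((1 : Matrix S S ℂ) ⊗ₖ pw σ' (-θ / 2 : ℝ)) * GG A ε Ψ with hG1
  have hcc : c θ * star (c θ) = ((h ^ (θ - 1) : ℝ) : ℂ) := by
    rw [Complex.star_def, Complex.mul_conj, Complex.normSq_eq_norm_sq, hcn, Complex.ofReal_re,
      ← Real.rpow_natCast, ← Real.rpow_mul hpos.le]
    congr 2; push_cast; ring
  rw [hGθ, sh_smul, Matrix.conjTranspose_smul, Matrix.smul_mul, Matrix.mul_smul, smul_smul, hcc,
    pw_smul_of_pos (Matrix.isHermitian_mul_conjTranspose_self _) (Real.rpow_pos_of_pos hpos _),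
    Matrix.trace_smul, smul_eq_mul, Complex.re_ofReal_mul, ← Real.rpow_mul hpos.le] at hmain
  have e2 : (θ - 1) * p = -1 := by linarith
  rw [e2, Real.rpow_neg_one, inv_mul_le_iff₀ hpos] at hmain
  exact hmain

end CoreBound

section Kraus
variable {A B : Type*} [Fintype A] [DecidableEq A] [Fintype B] [DecidableEq B]

/-- Every quantum channel has a Stinespring isometry. -/
theorem IsCPTP.exists_kraus {Φ : Matrix A A ℂ →ₗ[ℂ] Matrix B B ℂ} (h : IsCPTP Φ) :
    ∃ V : Matrix (B × (Fin (Fintype.card A) × B)) A ℂ, Vᴴ * V = 1 ∧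
      (∀ x b b', Φ x b b' = ∑ k, ∑ a, ∑ a', x a a' * (V (b, k) a * star (V (b', k) a'))) := by
  set e := Fintype.equivFin A
  set w : Fin (Fintype.card A) × A → ℂ := fun x => if e x.2 = x.1 then 1 else 0 with hw
  have hC := h.cp _ _ (Matrix.posSemidef_vecMulVec_self_star w)
  set C := (lext Φ) (Matrix.vecMulVec w (star w)) with hCdef
  have hCe : ∀ a a' b b', C (e a, b) (e a', b') = Φ (Matrix.single a a' 1) b b' := by
    intro a a' b b'
    have : (Matrix.of fun x x' => Matrix.vecMulVec w (star w) (e a, x) (e a', x'))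
        = Matrix.single a a' (1 : ℂ) := by
      ext x x'
      by_cases h1 : a = x <;> by_cases h2 : a' = x' <;>
        simp [hw, Matrix.vecMulVec_apply, Matrix.single, h1, h2, eq_comm]
    rw [← this]; rfl
  set L := pw C (1 / 2 : ℝ)
  have hL : C = L * Lᴴ := by
    rw [(pw_real_isHermitian C _).eq, ← pw_add' hC.1 (w := (1 : ℝ)) (by push_cast; ring)]
    simpa using (pw_one hC).symm
  have hLe : ∀ a a' b b', ∑ k, L (e a, b) k * star (L (e a', b') k)
      = Φ (Matrix.single a a' 1) b b' := by
    intro a a' b b'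
    rw [← hCe, hL, Matrix.mul_apply]; rfl
  refine ⟨Matrix.of fun b a => L (e a, b.1) b.2, ?_, ?_⟩
  · ext a a'
    have : ∑ b, Φ (Matrix.single a' a 1) b b = if a = a' then 1 else 0 := by
      have := h.tp (Matrix.single a' a 1)
      rw [Matrix.trace] at this
      simp only [Matrix.diag_apply] at this
      rw [this]
      by_cases h : a = a'
      · subst h; simp
      · rw [Matrix.trace_single_eq_of_ne _ _ _ (Ne.symm h), if_neg h]
    rw [Matrix.one_apply, ← this, Matrix.mul_apply, Fintype.sum_prod_type]
    refine Finset.sum_congr rfl fun b _ => ?_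
    rw [← hLe]
    exact Finset.sum_congr rfl fun k _ => mul_comm _ _
  · intro x b b'
    have hx : Φ x = ∑ a, ∑ a', x a a' • Φ (Matrix.single a a' 1) := by
      conv_lhs => rw [Matrix.matrix_eq_sum_single x]
      simp only [map_sum, ← _root_.map_smul, Matrix.smul_single, smul_eq_mul, mul_one]
    simp only [hx, Matrix.sum_apply, Matrix.smul_apply, smul_eq_mul, ← hLe, Matrix.of_apply]
    rw [Finset.sum_comm (s := (Finset.univ : Finset (Fin (Fintype.card A) × B)))]
    refine Finset.sum_congr rfl fun a _ => ?_
    rw [Finset.sum_comm (s := (Finset.univ : Finset (Fin (Fintype.card A) × B)))]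
    exact Finset.sum_congr rfl fun a' _ => Finset.mul_sum _ _ _

lemma trace_traceOut {X : Type*} [Fintype X] (e : X ≃ A × B) (ρ : Matrix X X ℂ) :
    (traceOut e ρ).trace = ρ.trace := by
  simp only [Matrix.trace, traceOut, Matrix.diag_apply, Matrix.of_apply]
  rw [← e.symm.sum_comp, Fintype.sum_prod_type]

lemma IsCPTP.trace_lext {R : Type*} [Fintype R] {Φ : Matrix A A ℂ →ₗ[ℂ] Matrix B B ℂ}
    (h : IsCPTP Φ) (ρ : Matrix (R × A) (R × A) ℂ) : ((lext Φ) ρ).trace = ρ.trace := by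
  simp only [Matrix.trace, Fintype.sum_prod_type, Matrix.diag_apply]
  refine Finset.sum_congr rfl fun r _ => ?_
  exact h.tp (Matrix.of fun a a' => ρ (r, a) (r, a'))

end Kraus

section Divergence
variable {X Y F : Type*} [Fintype X] [DecidableEq X] [Fintype Y] [DecidableEq Y] [Fintype F]
  [DecidableEq F]

lemma suppSubset_iff_mul_pw_zero {N Z : Matrix X X ℂ} (hZ : Z.PosSemidef) :
    suppSubset N Z ↔ N * pw Z 0 = N := by
  constructor
  · intro h
    have h1 : N * (1 - pw Z 0) = 0 := by
      ext i j
      have : Z *ᵥ ((1 - pw Z 0).col j) = 0 := by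
        ext k
        have : (Z * (1 - pw Z 0)) k j = 0 := by
          rw [Matrix.mul_sub, Matrix.mul_one, self_mul_pw_zero hZ, sub_self]; rfl
        exact this
      exact congrFun (h _ this) i
    rw [Matrix.mul_sub, Matrix.mul_one, sub_eq_zero] at h1
    exact h1.symm
  · intro h v hv
    have h2 : pw Z 0 = pw Z (-1) * Z := by
      rw [pw_real_mul_self hZ]
      exact pw_congr_arg (by norm_num)
    rw [← h, h2, ← Matrix.mulVec_mulVec, ← Matrix.mulVec_mulVec, hv, Matrix.mulVec_zero,
      Matrix.mulVec_zero]

lemma mpow_submatrix {A : Matrix X X ℂ} (h : A.IsHermitian) (c : Y ≃ X) (p : ℝ) :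
    mpow (A.submatrix c c) p = (mpow A p).submatrix c c := by
  simp only [mpow_eq_spec]
  exact spec_reindex h c _

lemma DR_submatrix (α : ℝ) {N Z : Matrix X X ℂ} (hN : N.IsHermitian) (hZ : Z.IsHermitian)
    (c : Y ≃ X) : DR α (N.submatrix c c) (Z.submatrix c c) = DR α N Z := by
  have ht : ∀ B : Matrix X X ℂ, (B.submatrix c c).trace = B.trace := fun B =>
    c.sum_comp fun x => B x x
  rw [DR, DR, mpow_submatrix hZ, Matrix.submatrix_mul_equiv, Matrix.submatrix_mul_equiv,
    mpow_submatrix, ht, ht]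
  have : (mpow Z ((1 - α) / (2 * α))).IsHermitian := by
    rw [mpow_eq_spec]; exact spec_isHermitian _ fun x => Complex.conj_ofReal _
  have h3 := Matrix.isHermitian_conjTranspose_mul_mul (mpow Z ((1 - α) / (2 * α))) hN
  rwa [this.eq] at h3

lemma DR_mul_conjTranspose {α r : ℝ} (hα0 : α ≠ 0) (hα1 : α ≠ 1) (hr : (1 - α) / (2 * α) = r)
    {Z : Matrix X X ℂ} (hZ : Z.PosSemidef) (T : Matrix X F ℂ) (hT : (T * Tᴴ).trace = 1) :
    DR α (T * Tᴴ) Z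
      = (α - 1)⁻¹ * Real.logb 2 (pw ((pw Z r * T) * (pw Z r * T)ᴴ) α).trace.re := by
  have hr0 : r ≠ 0 := by
    rw [← hr]; exact div_ne_zero (sub_ne_zero.2 hα1.symm) (mul_ne_zero two_ne_zero hα0)
  have h1 : pw Z r * (T * Tᴴ) * pw Z r = (pw Z r * T) * (pw Z r * T)ᴴ := by
    rw [Matrix.conjTranspose_mul, (pw_real_isHermitian Z r).eq]
    simp only [Matrix.mul_assoc]
  rw [DR, hr, ← pw_eq_mpow hZ hr0, h1, ← pw_eq_mpow (Matrix.posSemidef_self_mul_conjTranspose _) hα0,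
    hT, Complex.one_re, div_one]

end Divergence

section Conversion
variable {S R E S' R' E' I K K' : Type*} [Fintype S] [DecidableEq S] [Fintype R] [DecidableEq R]
  [Fintype E] [DecidableEq E] [Fintype S'] [DecidableEq S'] [Fintype R'] [DecidableEq R']
  [Fintype E'] [DecidableEq E'] [Fintype I] [DecidableEq I] [Fintype K] [DecidableEq K]
  [Fintype K'] [DecidableEq K']

/-- A Stinespring isometry of a channel `I → S' R' E'`, with output registers reordered. -/
def IsKraus (M : Matrix I I ℂ →ₗ[ℂ] Matrix (S' × (R' × E')) (S' × (R' × E')) ℂ)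
    (A : Matrix (E' × (S' × (R' × K))) I ℂ) : Prop :=
  ∀ x s r e s₂ r₂ e₂, M x (s, (r, e)) (s₂, (r₂, e₂)) = ∑ k, ∑ i, ∑ j,
    x i j * (A (e, (s, (r, k))) i * star (A (e₂, (s₂, (r₂, k))) j))

/-- `(S × S') × E' ≃ (S × E') × S'`. -/
def swapLast (S S' E' : Type*) : (S × S') × E' ≃ (S × E') × S' where
  toFun x := ((x.1.1, x.2), x.1.2)
  invFun x := ((x.1.1, x.2), x.1.2)
  left_inv _ := rfl
  right_inv _ := rfl

/-- `S' × (E' × T) ≃ (T × E') × S'`. -/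
def rotLast (T S' E' : Type*) : S' × (E' × T) ≃ (T × E') × S' where
  toFun x := ((x.2.2, x.2.1), x.1)
  invFun x := (x.2, (x.1.2, x.1.1))
  left_inv _ := rfl
  right_inv _ := rfl

variable {M : Matrix I I ℂ →ₗ[ℂ] Matrix (S' × (R' × E')) (S' × (R' × E')) ℂ}
  {A : Matrix (E' × (S' × (R' × K))) I ℂ}

lemma IsKraus.sum_apply (hA : IsKraus M A) {X P : Type*} [Fintype P] (L : Matrix (X × I) P ℂ)
    (x x₂ : X) (s s₂ : S') (e e₂ : E') :
    ∑ r, M (Matrix.of fun i j => (L * Lᴴ) (x, i) (x₂, j)) (s, (r, e)) (s₂, (r, e₂))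
      = ∑ b : (R' × K) × P, (∑ i, A (e, (s, b.1)) i * L (x, i) b.2) *
        star (∑ i, A (e₂, (s₂, b.1)) i * L (x₂, i) b.2) := by
  simp only [Fintype.sum_prod_type]
  refine Finset.sum_congr rfl fun r _ => ?_
  rw [hA]
  refine Finset.sum_congr rfl fun k _ => ?_
  have h1 := sum_sesquilinear (fun p i => L (x, i) p) (fun p i => L (x₂, i) p)
    (fun i => A (e, (s, (r, k))) i) (fun i => A (e₂, (s₂, (r, k))) i)
  simp only [mul_comm (L _ _)] at h1
  rw [h1]
  refine Finset.sum_congr rfl fun i _ => Finset.sum_congr rfl fun j _ => ?_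
  rw [mul_comm]
  congr 1
  exact Finset.sum_congr rfl fun _ _ => mul_comm _ _

lemma IsKraus.traceOut_e1 (hA : IsKraus M A) (ε : I ≃ R × E) {P : Type*} [Fintype P]
    (L : Matrix (S × I) P ℂ) :
    traceOut (e1 S S' R' E') ((lext M) (L * Lᴴ))
      = (sh (GG A ε (Matrix.of fun a b => L (a.1, ε.symm (b.1, a.2)) b.2)) *
        (sh (GG A ε (Matrix.of fun a b => L (a.1, ε.symm (b.1, a.2)) b.2)))ᴴ).submatrix
          (swapLast S S' E') (swapLast S S' E') := by
  ext ⟨⟨t, s⟩, e⟩ ⟨⟨t₂, s₂⟩, e₂⟩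
  refine (hA.sum_apply L t t₂ s s₂ e e₂).trans ?_
  simp only [Matrix.submatrix_apply, swapLast, Equiv.coe_fn_mk, sh, GG, Matrix.mul_apply,
    Matrix.conjTranspose_apply, Matrix.of_apply, Prod.mk.eta, Equiv.symm_apply_apply]

lemma IsKraus.traceOut_e2 (hA : IsKraus M A) (κ : Matrix I I ℂ) :
    traceOut (e2 I S' R' E') ((lext M) (pureState fun x => κ x.1 x.2))
      = (sh (GI A κ) * (sh (GI A κ))ᴴ).submatrix (rotLast I S' E') (rotLast I S' E') := by
  ext ⟨s, ⟨e, t⟩⟩ ⟨s₂, ⟨e₂, t₂⟩⟩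
  have h : pureState (fun x : I × I => κ x.1 x.2) = (Matrix.of fun x (_ : Unit) => κ x.1 x.2) *
      (Matrix.of fun x (_ : Unit) => κ x.1 x.2)ᴴ := by
    ext x y
    simp [pureState, Matrix.vecMulVec_apply, Matrix.mul_apply]
  rw [h]
  refine (hA.sum_apply _ t t₂ s s₂ e e₂).trans ?_
  simp [rotLast, sh, GI, Matrix.mul_apply, Fintype.sum_prod_type]

end Conversion

section ChainRule
variable {S R E S' R' E' I K K' : Type*} [Fintype S] [DecidableEq S] [Fintype R] [DecidableEq R]
  [Fintype E] [DecidableEq E] [Fintype S'] [DecidableEq S'] [Fintype R'] [DecidableEq R']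
  [Fintype E'] [DecidableEq E'] [Fintype I] [DecidableEq I] [Fintype K] [DecidableEq K]
  [Fintype K'] [DecidableEq K']
  {M : Matrix I I ℂ →ₗ[ℂ] Matrix (S' × (R' × E')) (S' × (R' × E')) ℂ}
  {A : Matrix (E' × (S' × (R' × K))) I ℂ}

lemma isState_pureState {κ : Matrix I I ℂ} (hκ : hs κ = 1) :
    IsState (pureState fun x : I × I => κ x.1 x.2) := by
  refine ⟨Matrix.posSemidef_vecMulVec_self_star _, ?_⟩
  have h : ((hs κ : ℝ) : ℂ) = 1 := by rw [hκ]; rfl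
  rw [← h]
  simp [hs, pureState, Matrix.trace, Matrix.vecMulVec_apply, Fintype.sum_prod_type,
    Complex.mul_conj, Complex.normSq_eq_norm_sq]

lemma IsState.ptB_isometry {B : Matrix (E' × K') E ℂ} (hB : Bᴴ * B = 1) {σ : Matrix E E ℂ}
    (hσ : IsState σ) : IsState (ptB (B * σ * Bᴴ)) := by
  refine ⟨ptB_posSemidef (hσ.1.mul_mul_conjTranspose_same B), ?_⟩
  have : (ptB (B * σ * Bᴴ)).trace = (B * σ * Bᴴ).trace := by
    simp [Matrix.trace, ptB, Fintype.sum_prod_type]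
  rw [this, Matrix.trace_mul_cycle, hB, Matrix.one_mul, hσ.2]

/-- The value of `Hdn` on the channel output of a pure state. -/
lemma IsKraus.Hdn_eq (hA : IsKraus M A) (hM : IsCPTP M) {s q : ℝ} (hs0 : 0 < s) (hs1 : s < 1)
    (hq : q = 1 / (1 - s)) {κ : Matrix I I ℂ} (hκ : hs κ = 1)
    (hbot : Hdn q (traceOut (e2 I S' R' E') ((lext M) (pureState fun x => κ x.1 x.2))) ≠ ⊥) :
    Hdn q (traceOut (e2 I S' R' E') ((lext M) (pureState fun x => κ x.1 x.2)))
      = ((-((q - 1)⁻¹ * Real.logb 2 (cq s q (GI A κ))) : ℝ) : EReal) := by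
  have htr : (traceOut (e2 I S' R' E') ((lext M) (pureState fun x => κ x.1 x.2))).trace = 1 := by
    rw [trace_traceOut, hM.trace_lext, (isState_pureState hκ).2]
  rw [hA.traceOut_e2] at hbot htr ⊢
  set G := GI A κ with hG
  have hm : (1 : Matrix S' S' ℂ) ⊗ₖ
      ptA ((sh G * (sh G)ᴴ).submatrix (rotLast I S' E') (rotLast I S' E'))
      = (((G * Gᴴ).submatrix Prod.swap Prod.swap).submatrix Prod.swap Prod.swap ⊗ₖ
        (1 : Matrix S' S' ℂ)).submatrix (rotLast I S' E') (rotLast I S' E') := by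
    ext ⟨s, ⟨e, t⟩⟩ ⟨s₂, ⟨e₂, t₂⟩⟩
    simp [rotLast, ptA, sh, Matrix.mul_apply, Fintype.sum_prod_type, mul_comm]
  have hm' : (((G * Gᴴ).submatrix Prod.swap Prod.swap).submatrix Prod.swap Prod.swap) = G * Gᴴ := by
    ext; simp
  rw [hm'] at hm
  have hGp := Matrix.posSemidef_self_mul_conjTranspose G
  have hZ : ((G * Gᴴ) ⊗ₖ (1 : Matrix S' S' ℂ)).PosSemidef := hGp.kronecker Matrix.PosSemidef.one
  have h1s : 1 - s ≠ 0 := by linarith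
  have hq0 : q ≠ 0 := by rw [hq]; positivity
  have hq1 : q ≠ 1 := by rw [hq]; intro h; field_simp at h; linarith
  have hqs : (1 - q) / (2 * q) = -s / 2 := by rw [hq]; field_simp; ring
  have hDR : DR q ((sh G * (sh G)ᴴ).submatrix (rotLast I S' E') (rotLast I S' E'))
      (((G * Gᴴ) ⊗ₖ (1 : Matrix S' S' ℂ)).submatrix (rotLast I S' E') (rotLast I S' E'))
      = (q - 1)⁻¹ * Real.logb 2 (cq s q G) := by
    rw [DR_submatrix _ (Matrix.isHermitian_mul_conjTranspose_self _) hZ.1,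
      DR_mul_conjTranspose hq0 hq1 hqs hZ, pw_kron_one hGp.1, ← sh_mul, cq]
    rw [← htr]
    exact ((rotLast I S' E').sum_comp fun x => (sh G * (sh G)ᴴ) x x).symm
  rw [Hdn, D] at hbot ⊢
  split_ifs at hbot ⊢ with hc
  · rw [hm, hDR, EReal.coe_neg]
  · exact absurd EReal.neg_top hbot

theorem IsKraus.chain_rule (hA : IsKraus M A) (hM : IsCPTP M) (ε : I ≃ R × E)
    {B : Matrix (E' × K') E ℂ} (hB : Bᴴ * B = 1)
    (hNS : ∀ e e' i j, ∑ b, A (e, b) i * star (A (e', b) j)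
      = if (ε i).1 = (ε j).1 then ∑ k, B (e, k) (ε i).2 * star (B (e', k) (ε j).2) else 0)
    {α : ℝ} (hα1 : 1 < α) (hα2 : α < 2) {ρ : Matrix (S × I) (S × I) ℂ} (hρ : IsState ρ) :
    HUp α (traceOut (((Equiv.refl S).prodCongr ε).trans (e4 S R E)) ρ)
        + sInf {x : EReal | ∃ ω : Matrix (I × I) (I × I) ℂ, IsState ω ∧
            x = Hdn (1 / (2 - α)) (traceOut (e2 I S' R' E') ((lext M) ω))}
      ≤ HUp α (traceOut (e1 S S' R' E') ((lext M) ρ)) := by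
  have hI : Nonempty I := by
    by_contra h
    rw [not_nonempty_iff] at h
    have := hρ.2
    simp [Matrix.trace] at this
  obtain ⟨s, hsα⟩ : ∃ s, s = α - 1 := ⟨_, rfl⟩
  obtain ⟨θ, hθ⟩ : ∃ θ, θ = s / (1 + s) := ⟨_, rfl⟩
  have hs0 : 0 < s := by linarith
  have hs1 : s < 1 := by linarith
  have hp : α = 1 + s := by linarith
  have hq : 1 / (2 - α) = 1 / (1 - s) := by rw [hsα]; ring_nf
  generalize 1 / (2 - α) = q at hq ⊢
  set k := sInf {x : EReal | ∃ ω : Matrix (I × I) (I × I) ℂ, IsState ω ∧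
    x = Hdn q (traceOut (e2 I S' R' E') ((lext M) ω))} with hk
  rcases eq_or_ne k ⊥ with hkb | hkb
  · rw [hkb, EReal.add_bot]; exact bot_le
  have hHdn : ∀ κ : Matrix I I ℂ, hs κ = 1 →
      k ≤ ((-((q - 1)⁻¹ * Real.logb 2 (cq s q (GI A κ))) : ℝ) : EReal) := by
    intro κ hκ
    have h1 : k ≤ Hdn q (traceOut (e2 I S' R' E') ((lext M) (pureState fun x => κ x.1 x.2))) :=
      sInf_le ⟨_, isState_pureState hκ, rfl⟩
    rw [hA.Hdn_eq hM hs0 hs1 hq hκ fun h => hkb (le_bot_iff.1 (h ▸ h1))] at h1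
    exact h1
  have hkt : k ≠ ⊤ := by
    obtain ⟨i⟩ := hI
    intro h
    have := hHdn (Matrix.single i i 1) (by
      simp [hs, Matrix.single, ite_and, apply_ite])
    rw [h, top_le_iff] at this
    exact EReal.coe_ne_top _ this
  obtain ⟨k', hk'⟩ : ∃ k' : ℝ, k = (k' : EReal) := ⟨k.toReal, (EReal.coe_toReal hkt hkb).symm⟩
  have h1s : 0 < 1 - s := by linarith
  have hqs : q - 1 = s / (1 - s) := by rw [hq]; field_simp; ring
  have hq1 : 0 < q - 1 := by rw [hqs]; positivity
  have hK : ∀ κ : Matrix I I ℂ, hs κ = 1 → cq s q (GI A κ) ≤ (2 : ℝ) ^ (-((q - 1) * k')) := by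
    intro κ hκ
    rcases (cq_nonneg s q (GI A κ)).eq_or_lt with h0 | h0
    · rw [← h0]; positivity
    have := hHdn κ hκ
    rw [hk', EReal.coe_le_coe_iff] at this
    rw [← Real.logb_le_iff_le_rpow one_lt_two h0]
    have h3 : (q - 1) * k' ≤ (q - 1) * -((q - 1)⁻¹ * Real.logb 2 (cq s q (GI A κ))) := by gcongr
    rw [mul_neg, ← mul_assoc, mul_inv_cancel₀ hq1.ne', one_mul] at h3
    linarith
  -- a purification of `ρ`
  set L := pw ρ (1 / 2 : ℝ) with hLdef
  have hL : ρ = L * Lᴴ := by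
    rw [(pw_real_isHermitian ρ _).eq, ← pw_add' hρ.1.1 (w := (1 : ℝ)) (by push_cast; ring)]
    simpa using (pw_one hρ.1).symm
  set Ψ : Matrix (S × E) (R × (S × I)) ℂ :=
    Matrix.of fun a b => L (a.1, ε.symm (b.1, a.2)) b.2 with hΨdef
  have hSE : traceOut (((Equiv.refl S).prodCongr ε).trans (e4 S R E)) ρ = Ψ * Ψᴴ := by
    rw [hL]
    ext ⟨t, e⟩ ⟨t₂, e₂⟩
    simp only [hΨdef, traceOut, e4, Matrix.mul_apply, Matrix.conjTranspose_apply, Matrix.of_apply,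
      Fintype.sum_prod_type]
    rfl
  have hout := hA.traceOut_e1 ε L
  rw [← hL, ← hΨdef] at hout
  have htr1 : (Ψ * Ψᴴ).trace = 1 := by rw [← hSE, trace_traceOut, hρ.2]
  have hΨ0 : Ψ ≠ 0 := by
    rintro h
    rw [h, Matrix.zero_mul, Matrix.trace_zero] at htr1
    exact zero_ne_one htr1
  set G := GG A ε Ψ with hG
  have htr2 : (sh G * (sh G)ᴴ).trace = 1 := by
    have h1 : (traceOut (e1 S S' R' E') ((lext M) ρ)).trace = 1 := by
      rw [trace_traceOut, hM.trace_lext, hρ.2]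
    rw [hout] at h1
    rw [← h1]
    exact ((swapLast S S' E').sum_comp fun x => (sh G * (sh G)ᴴ) x x).symm
  rw [hk', hSE, hout, HUp, HUp]
  have hr : (1 - α) / (2 * α) = -θ / 2 := by rw [hθ, hp]; field_simp; ring
  have hα0 : α ≠ 0 := by linarith
  have hmain : ∀ σ : Matrix E E ℂ, IsState σ →
      D α (Ψ * Ψᴴ) ((1 : Matrix S S ℂ) ⊗ₖ σ) ≠ ⊤ → ∃ σ' : Matrix E' E' ℂ, IsState σ' ∧
        D α ((sh G * (sh G)ᴴ).submatrix (swapLast S S' E') (swapLast S S' E'))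
          ((1 : Matrix (S × S') (S × S') ℂ) ⊗ₖ σ') + (k' : EReal)
        ≤ D α (Ψ * Ψᴴ) ((1 : Matrix S S ℂ) ⊗ₖ σ) := by
    intro σ hσ hD
    refine ⟨ptB (B * σ * Bᴴ), hσ.ptB_isometry hB, ?_⟩
    have hZp : ((1 : Matrix S S ℂ) ⊗ₖ σ).PosSemidef := Matrix.PosSemidef.one.kronecker hσ.1
    have hsupp : suppSubset (Ψ * Ψᴴ) ((1 : Matrix S S ℂ) ⊗ₖ σ) := by
      by_contra h
      rw [D, if_neg (by simp [h, hα1.le])] at hD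
      exact hD rfl
    have hΨ : ((1 : Matrix S S ℂ) ⊗ₖ pw σ 0) * Ψ = Ψ := by
      have h1 := (suppSubset_iff_mul_pw_zero hZp).1 hsupp
      rw [pw_one_kron hσ.1.1] at h1
      have h2 := congrArg Matrix.conjTranspose h1
      rw [Matrix.conjTranspose_mul, one_kron_conjTranspose, pw_conjTranspose, star_zero,
        (Matrix.isHermitian_mul_conjTranspose_self Ψ).eq] at h2
      have h3 : (((1 : Matrix S S ℂ) ⊗ₖ pw σ 0) - 1) * (Ψ * Ψᴴ) = 0 := by
        rw [Matrix.sub_mul, Matrix.one_mul, h2, sub_self]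
      rw [Matrix.mul_self_mul_conjTranspose_eq_zero, Matrix.sub_mul, Matrix.one_mul,
        sub_eq_zero] at h3
      exact h3
    set σ' := ptB (B * σ * Bᴴ) with hσ'
    have hkd : KrausData A ε B σ σ' :=
      ⟨contr_of_conjTranspose_mul_self (hB ▸ contr_one), hNS, hσ.1, hσ'⟩
    have hσp := hkd.posSemidef'
    have hZ' : ((1 : Matrix (S × S') (S × S') ℂ) ⊗ₖ σ')
        = (((1 : Matrix S S ℂ) ⊗ₖ σ') ⊗ₖ (1 : Matrix S' S' ℂ)).submatrix
          (swapLast S S' E') (swapLast S S' E') := by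
      ext ⟨⟨t, s⟩, e⟩ ⟨⟨t₂, s₂⟩, e₂⟩
      by_cases h1 : t = t₂ <;> by_cases h2 : s = s₂ <;> simp [swapLast, h1, h2]
    have h1p : ((1 : Matrix S S ℂ) ⊗ₖ σ').PosSemidef := Matrix.PosSemidef.one.kronecker hσp
    have hZ'p : (((1 : Matrix S S ℂ) ⊗ₖ σ') ⊗ₖ (1 : Matrix S' S' ℂ)).PosSemidef :=
      h1p.kronecker Matrix.PosSemidef.one
    have hpw : ∀ w : ℂ, pw (((1 : Matrix S S ℂ) ⊗ₖ σ') ⊗ₖ (1 : Matrix S' S' ℂ)) w * sh G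
        = sh (((1 : Matrix S S ℂ) ⊗ₖ pw σ' w) * G) := by
      intro w
      rw [pw_kron_one h1p.1, pw_one_kron hσp.1, ← sh_mul]
    have hG0 : ((1 : Matrix S S ℂ) ⊗ₖ pw σ' 0) * G = G := hkd.supp_GG hΨ
    have hsupp' : suppSubset ((sh G * (sh G)ᴴ).submatrix (swapLast S S' E') (swapLast S S' E'))
        ((1 : Matrix (S × S') (S × S') ℂ) ⊗ₖ σ') := by
      rw [suppSubset_iff_mul_pw_zero (Matrix.PosSemidef.one.kronecker hσp), hZ', pw,
        spec_reindex hZ'p.1, Matrix.submatrix_mul_equiv]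
      congr 1
      have h1 := hpw 0
      rw [hG0] at h1
      have h2 := congrArg Matrix.conjTranspose h1
      rw [Matrix.conjTranspose_mul, pw_conjTranspose, star_zero] at h2
      rw [Matrix.mul_assoc]
      exact congrArg _ h2
    rw [D, D, if_pos (Or.inr hsupp'), if_pos (Or.inr hsupp), ← EReal.coe_add,
      EReal.coe_le_coe_iff, hZ', DR_submatrix _ (Matrix.isHermitian_mul_conjTranspose_self _) hZ'p.1,
      DR_mul_conjTranspose hα0 hα1.ne' hr hZ'p _ htr2, DR_mul_conjTranspose hα0 hα1.ne' hr hZp _ htr1,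
      hpw, pw_one_kron hσ.1.1, ← hsα]
    have hch := hkd.chain hs0 hs1 hq hp hθ hK hΨ0 hΨ
    rw [← hG] at hch
    have hpos : 0 < (pw (sh (((1 : Matrix S S ℂ) ⊗ₖ pw σ' (-θ / 2 : ℝ)) * G) *
        (sh (((1 : Matrix S S ℂ) ⊗ₖ pw σ' (-θ / 2 : ℝ)) * G))ᴴ) α).trace.re := by
      refine trace_pw_pos (Matrix.posSemidef_self_mul_conjTranspose _) (fun h0 => ?_) α
      rw [Matrix.self_mul_conjTranspose_eq_zero, ← hpw] at h0
      have h1 : sh G = 0 := by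
        conv_lhs => rw [← hG0]
        rw [← hpw, pw_add' hZ'p.1 (w := 0) (u := (θ / 2 : ℝ)) (v := (-θ / 2 : ℝ))
          (by push_cast; ring), Matrix.mul_assoc, h0, Matrix.mul_zero]
      rw [h1, Matrix.zero_mul, Matrix.trace_zero] at htr2
      exact zero_ne_one htr2
    generalize (pw (sh (((1 : Matrix S S ℂ) ⊗ₖ pw σ' (-θ / 2 : ℝ)) * G) *
        (sh (((1 : Matrix S S ℂ) ⊗ₖ pw σ' (-θ / 2 : ℝ)) * G))ᴴ) α).trace.re = T' at hch hpos ⊢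
    generalize (pw ((((1 : Matrix S S ℂ) ⊗ₖ pw σ (-θ / 2 : ℝ)) * Ψ) *
        (((1 : Matrix S S ℂ) ⊗ₖ pw σ (-θ / 2 : ℝ)) * Ψ)ᴴ) α).trace.re = T at hch ⊢
    rw [← Real.rpow_mul two_pos.le] at hch
    have he : -((q - 1) * k') * (1 - s) = -(s * k') := by rw [hqs]; field_simp
    rw [he] at hch
    have h2 : (0 : ℝ) < 2 ^ (-(s * k')) := by positivity
    have hT : 0 < T := (mul_pos_iff_of_pos_right h2).1 (hpos.trans_le hch)
    have h3 := Real.logb_le_logb_of_le one_lt_two hpos hch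
    rw [Real.logb_mul hT.ne' h2.ne', Real.logb_rpow two_pos (by norm_num)] at h3
    have h4 : s⁻¹ * Real.logb 2 T' ≤ s⁻¹ * (Real.logb 2 T + -(s * k')) := by gcongr
    have h5 : s⁻¹ * (Real.logb 2 T + -(s * k')) = s⁻¹ * Real.logb 2 T - k' := by
      field_simp; ring
    linarith
  have hfin : sInf {x : EReal | ∃ σ' : Matrix E' E' ℂ, IsState σ' ∧
      x = D α ((sh G * (sh G)ᴴ).submatrix (swapLast S S' E') (swapLast S S' E'))
          ((1 : Matrix (S × S') (S × S') ℂ) ⊗ₖ σ')} + (k' : EReal)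
      ≤ sInf {x : EReal | ∃ σ : Matrix E E ℂ, IsState σ ∧
        x = D α (Ψ * Ψᴴ) ((1 : Matrix S S ℂ) ⊗ₖ σ)} := by
    refine le_sInf ?_
    rintro x ⟨σ, hσ, rfl⟩
    rcases eq_or_ne (D α (Ψ * Ψᴴ) ((1 : Matrix S S ℂ) ⊗ₖ σ)) ⊤ with h | h
    · rw [h]; exact le_top
    obtain ⟨σ', hσ', hle⟩ := hmain σ hσ h
    exact (add_le_add (sInf_le (by exact ⟨σ', hσ', rfl⟩)) le_rfl).trans hle
  generalize sInf {x : EReal | ∃ σ' : Matrix E' E' ℂ, IsState σ' ∧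
      x = D α ((sh G * (sh G)ᴴ).submatrix (swapLast S S' E') (swapLast S S' E'))
          ((1 : Matrix (S × S') (S × S') ℂ) ⊗ₖ σ')} = a at hfin ⊢
  generalize sInf {x : EReal | ∃ σ : Matrix E E ℂ, IsState σ ∧
        x = D α (Ψ * Ψᴴ) ((1 : Matrix S S ℂ) ⊗ₖ σ)} = b at hfin ⊢
  induction a with
  | bot => simp
  | top => 
    rw [EReal.top_add_coe, top_le_iff] at hfin
    rw [hfin]; simp
  | coe a =>
    induction b with
    | bot => simp [← EReal.coe_add] at hfin
    | top => simp
    | coe b =>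
      norm_cast at hfin ⊢
      linarith

end ChainRule

/-- A channel has a Stinespring isometry with output registers in the order of `IsKraus`. -/
lemma IsCPTP.exists_isKraus {I S' R' E' : Type*} [Fintype I] [DecidableEq I] [Fintype S']
    [DecidableEq S'] [Fintype R'] [DecidableEq R'] [Fintype E'] [DecidableEq E']
    {M : Matrix I I ℂ →ₗ[ℂ] Matrix (S' × (R' × E')) (S' × (R' × E')) ℂ} (hM : IsCPTP M) :
    ∃ A : Matrix (E' × (S' × (R' × (Fin (Fintype.card I) × (S' × (R' × E')))))) I ℂ,
      Aᴴ * A = 1 ∧ IsKraus M A := by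
  obtain ⟨V, hV, hVM⟩ := hM.exists_kraus
  refine ⟨Matrix.of fun x i => V ((x.2.1, (x.2.2.1, x.1)), x.2.2.2) i, ?_, ?_⟩
  · rw [← hV]
    ext i j
    simp only [Matrix.mul_apply, Matrix.conjTranspose_apply, Matrix.of_apply]
    exact (⟨fun x => ((x.2.1, (x.2.2.1, x.1)), x.2.2.2),
      fun x => (x.1.2.2, (x.1.1, (x.1.2.1, x.2))), fun _ => rfl, fun _ => rfl⟩ :
      E' × (S' × (R' × (Fin (Fintype.card I) × (S' × (R' × E')))))
        ≃ (S' × (R' × E')) × (Fin (Fintype.card I) × (S' × (R' × E')))).sum_comp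
        fun x => star (V x i) * V x j
  · intro x s r e s₂ r₂ e₂
    exact hVM _ _ _

lemma sum_single_mul {I : Type*} [Fintype I] [DecidableEq I] (i j : I) (f : I → I → ℂ) :
    ∑ a, ∑ b, Matrix.single i j (1 : ℂ) a b * f a b = f i j := by
  rw [Fintype.sum_eq_single i fun a ha => by simp [ha.symm],
    Fintype.sum_eq_single j fun b hb => by simp [hb.symm]]
  simp

theorem geat_chain_rule_HUp
    {S R E S' R' E' : Type*}
    [Fintype S] [DecidableEq S] [Fintype R] [DecidableEq R] [Fintype E] [DecidableEq E]
    [Fintype S'] [DecidableEq S'] [Fintype R'] [DecidableEq R'] [Fintype E'] [DecidableEq E']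
    (ρ : Matrix (S × (R × E)) (S × (R × E)) ℂ) (hρ : IsState ρ)
    (M : Matrix (R × E) (R × E) ℂ →ₗ[ℂ] Matrix (S' × (R' × E')) (S' × (R' × E')) ℂ)
    (hM : IsCPTP M)
    (α : ℝ) (hα1 : 1 < α) (hα2 : α < 2) :
    -- (i)
    (HUp α (traceOut (e1 S S' R' E') ((lext M) ρ))
      ≥ HUp α ρ
        + sInf {x : EReal | ∃ ω : Matrix ((R × E) × (R × E)) ((R × E) × (R × E)) ℂ,
            IsState ω ∧
            x = Hdn (1 / (2 - α)) (traceOut (e2 (R × E) S' R' E') ((lext M) ω))})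
    ∧
    -- (ii) under the non-signalling condition
    ((∃ Rch : Matrix E E ℂ →ₗ[ℂ] Matrix E' E' ℂ, IsCPTP Rch ∧
        ∀ τ : Matrix (R × E) (R × E) ℂ, traceOut (e3 S' R' E') (M τ) = Rch (ptA τ)) →
      HUp α (traceOut (e1 S S' R' E') ((lext M) ρ))
        ≥ HUp α (traceOut (e4 S R E) ρ)
          + sInf {x : EReal | ∃ ω : Matrix ((R × E) × (R × E)) ((R × E) × (R × E)) ℂ,
              IsState ω ∧
              x = Hdn (1 / (2 - α)) (traceOut (e2 (R × E) S' R' E') ((lext M) ω))}) := by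
  obtain ⟨A, hAA, hA⟩ := hM.exists_isKraus
  refine ⟨?_, ?_⟩
  · have h := hA.chain_rule hM (Equiv.punitProd.{0} (R × E)).symm hAA (by simp) hα1 hα2 hρ
    have h2 : traceOut (((Equiv.refl S).prodCongr (Equiv.punitProd.{0} (R × E)).symm).trans
        (e4 S PUnit.{1} (R × E))) ρ = ρ := by
      ext a b
      simp [traceOut, e4]
    rw [h2] at h
    exact h
  · rintro ⟨Rch, hR, hRM⟩
    obtain ⟨B, hB, hBR⟩ := hR.exists_kraus
    refine hA.chain_rule hM (Equiv.refl (R × E)) hB ?_ hα1 hα2 hρ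
    intro e e' i j
    have h := congrFun (congrFun (hRM (Matrix.single i j 1)) e) e'
    have hl : traceOut (e3 S' R' E') (M (Matrix.single i j 1)) e e'
        = ∑ b, A (e, b) i * star (A (e', b) j) := by
      simp only [traceOut, Matrix.of_apply]
      rw [Fintype.sum_prod_type, Fintype.sum_prod_type]
      refine Finset.sum_congr rfl fun s _ => ?_
      rw [Fintype.sum_prod_type]
      refine Finset.sum_congr rfl fun r _ => (hA _ s r e s r e').trans ?_
      simp only [sum_single_mul]
    rw [← hl, h]
    have hp : ptA (Matrix.single i j (1 : ℂ))
        = if i.1 = j.1 then Matrix.single i.2 j.2 1 else 0 := by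
      obtain ⟨r, x⟩ := i
      obtain ⟨r₂, x₂⟩ := j
      ext y y₂
      by_cases hr : r = r₂
      · subst hr
        simp [ptA, Matrix.single_apply, ite_and]
      · have : ∀ a, ¬ (r = a ∧ x = y ∧ r₂ = a ∧ x₂ = y₂) := fun a ha => hr (ha.1.trans ha.2.2.1.symm)
        simp [ptA, Matrix.single_apply, hr, and_assoc, this]
    rw [hp]
    by_cases hij : i.1 = j.1
    · refine Eq.trans ?_ (if_pos hij).symm
      rw [if_pos hij]
      refine (hBR _ e e').trans ?_
      simp only [sum_single_mul]
      rfl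
    · refine Eq.trans ?_ (if_neg hij).symm
      rw [if_neg hij, map_zero]; rfl

end QITLeak
end
end

section
/- For any normalized state ρ on registers A, B and any ε ∈ [0,1), the smoothed max-information I_max↓,ε(A;B)_ρ, defined as the infimum of I_∞↓(A;B)_ρ̃ over subnormalized states ρ̃ with P(ρ̃,ρ) ≤ ε, is attained by a normalized state; that is, I_max↓,ε(A;B)_ρ = inf over NORMALIZED states ρ̃ on AB with P(ρ̃,ρ) ≤ ε of I_∞↓(A;B)_ρ̃. -/
open scoped Kronecker
open Matrix
open scoped ComplexOrder

noncomputable section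
namespace QITLeak

variable {A B : Type*}

/-- `mpow` is an instance of the continuous functional calculus. -/
theorem mpow_eq_cfc [Fintype A] [DecidableEq A] {ρ : Matrix A A ℂ} (hρ : ρ.IsHermitian) (p : ℝ) :
    mpow ρ p = cfc (fun x : ℝ => x ^ p) ρ := by
  rw [hρ.cfc_eq, Matrix.IsHermitian.cfc, Unitary.conjStarAlgAut_apply, mpow, dif_pos hρ]
  rfl

theorem mpow_smul [Fintype A] [DecidableEq A] {ρ : Matrix A A ℂ} (hρ : ρ.PosSemidef)
    {c : ℝ} (hc : 0 ≤ c) (p : ℝ) : mpow (c • ρ) p = (c ^ p) • mpow ρ p := by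
  have hsa : IsSelfAdjoint ρ := hρ.isHermitian
  rw [mpow_eq_cfc (hρ.smul hc).isHermitian, mpow_eq_cfc hρ.isHermitian,
    ← cfc_comp_smul c (fun x : ℝ => x ^ p) ρ
      ((ρ.finite_real_spectrum.image _).continuousOn _) hsa,
    ← cfc_smul (c ^ p) (fun x : ℝ => x ^ p) ρ (ρ.finite_real_spectrum.continuousOn _)]
  refine cfc_congr fun x hx => ?_
  rw [hρ.isHermitian.spectrum_real_eq_range_eigenvalues] at hx
  obtain ⟨i, rfl⟩ := hx
  simp only [smul_eq_mul]
  exact Real.mul_rpow hc (hρ.eigenvalues_nonneg i)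

theorem trace_mpow_nonneg [Fintype A] [DecidableEq A] {ρ : Matrix A A ℂ} (hρ : ρ.PosSemidef)
    (p : ℝ) : 0 ≤ (mpow ρ p).trace.re := by
  rw [mpow, dif_pos hρ.isHermitian, Matrix.trace_mul_cycle, Unitary.coe_star_mul_self, one_mul,
    Matrix.trace_diagonal, Complex.re_sum]
  exact Finset.sum_nonneg fun i _ => Real.rpow_nonneg (hρ.eigenvalues_nonneg i) p

theorem traceNorm_nonneg [Fintype A] [DecidableEq A] (M : Matrix A A ℂ) : 0 ≤ traceNorm M :=
  trace_mpow_nonneg (posSemidef_conjTranspose_mul_self M) _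

theorem traceNorm_smul [Fintype A] [DecidableEq A] (M : Matrix A A ℂ) {c : ℝ} (hc : 0 ≤ c) :
    traceNorm (c • M) = c * traceNorm M := by
  have h : (c • M)ᴴ * (c • M) = (c ^ 2) • (Mᴴ * M) := by
    rw [conjTranspose_smul, star_trivial, smul_mul_smul_comm, sq]
  rw [traceNorm, h, mpow_smul (posSemidef_conjTranspose_mul_self M) (sq_nonneg c),
    ← Real.sqrt_eq_rpow, Real.sqrt_sq hc, trace_smul, Complex.smul_re, smul_eq_mul, traceNorm]

/-- Against a normalized state, the deficit term of the generalized fidelity vanishes. -/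
theorem gFid_of_isState_right [Fintype A] [DecidableEq A] (τ : Matrix A A ℂ) {ρ : Matrix A A ℂ}
    (hρ : IsState ρ) : gFid τ ρ = traceNorm (mpow τ (1 / 2 : ℝ) * mpow ρ (1 / 2 : ℝ)) := by
  simp [gFid, hρ.2]

theorem gFid_smul_left [Fintype A] [DecidableEq A] {τ ρ : Matrix A A ℂ} (hτ : τ.PosSemidef)
    (hρ : IsState ρ) {c : ℝ} (hc : 0 ≤ c) : gFid (c • τ) ρ = √c * gFid τ ρ := by
  rw [gFid_of_isState_right _ hρ, gFid_of_isState_right _ hρ, mpow_smul hτ hc, smul_mul_assoc,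
    ← Real.sqrt_eq_rpow, traceNorm_smul _ (Real.sqrt_nonneg c)]

theorem pDist_smul_le [Fintype A] [DecidableEq A] {τ ρ : Matrix A A ℂ} (hτ : τ.PosSemidef)
    (hρ : IsState ρ) {c : ℝ} (hc : 1 ≤ c) : pDist (c • τ) ρ ≤ pDist τ ρ := by
  have h0 : 0 ≤ gFid τ ρ := gFid_of_isState_right τ hρ ▸ traceNorm_nonneg _
  have h1 : gFid τ ρ ≤ gFid (c • τ) ρ := by
    rw [gFid_smul_left hτ hρ (zero_le_one.trans hc)]
    exact le_mul_of_one_le_left h0 (Real.one_le_sqrt.mpr hc)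
  exact Real.sqrt_le_sqrt (sub_le_sub_left (pow_le_pow_left₀ h0 h1 2) 1)

theorem pDist_zero_left [Fintype A] [DecidableEq A] {ρ : Matrix A A ℂ} (hρ : IsState ρ) :
    pDist 0 ρ = 1 := by
  have h := gFid_smul_left (PosSemidef.zero (n := A) (R := ℂ)) hρ le_rfl
  rw [smul_zero, Real.sqrt_zero, zero_mul] at h
  simp [pDist, h]

theorem Dmax_smul_smul [Fintype A] (ρ σ : Matrix A A ℂ) {c : ℝ} (hc : 0 < c) :
    Dmax (c • ρ) (c • σ) = Dmax ρ σ := by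
  have h : ∀ μ : ℝ, (μ • c • σ - c • ρ).PosSemidef ↔ (μ • σ - ρ).PosSemidef := fun μ => by
    rw [smul_comm, ← smul_sub]
    refine ⟨fun h => ?_, fun h => h.smul hc.le⟩
    simpa [smul_smul, hc.ne'] using h.smul (inv_nonneg.mpr hc.le)
  simp only [Dmax, h]

/-- `I_∞↓` is invariant under positive rescaling of the state. -/
theorem ImaxD_smul [Fintype A] [Fintype B]
    (ρ : Matrix (A × B) (A × B) ℂ) {c : ℝ} (hc : 0 < c) : ImaxD (c • ρ) = ImaxD ρ := by
  have h : ptB (c • ρ) = c • ptB ρ := by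
    ext a a'
    simp [ptB, Finset.mul_sum]
  simp only [ImaxD, h, smul_kronecker, Dmax_smul_smul _ _ hc]


/-! ## Statement 15
The smoothed max-information `I_max↓,ε(A;B)_ρ` of a normalized state is attained on
normalized states. -/

theorem smooth_ImaxD_attained_on_normalized
    {A B : Type*} [Fintype A] [DecidableEq A] [Fintype B] [DecidableEq B]
    (ρ : Matrix (A × B) (A × B) ℂ) (hρ : IsState ρ) (ε : ℝ) (hε0 : 0 ≤ ε) (hε1 : ε < 1) :
    ImaxDEps ε ρ =
      sInf {x : EReal | ∃ ρ' : Matrix (A × B) (A × B) ℂ,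
        IsState ρ' ∧ pDist ρ' ρ ≤ ε ∧ x = ImaxD ρ'} := by
  refine le_antisymm (le_sInf ?_) (le_sInf ?_)
  · rintro _ ⟨τ, hτ, hd, rfl⟩
    exact sInf_le ⟨τ, ⟨hτ.1, by simp [hτ.2]⟩, hd, rfl⟩
  · rintro _ ⟨τ, ⟨hτ, htr⟩, hd, rfl⟩
    have hne : τ ≠ 0 := by
      rintro rfl
      rw [pDist_zero_left hρ] at hd
      exact hε1.not_ge hd
    obtain ⟨h0, him⟩ := Complex.nonneg_iff.mp hτ.trace_nonneg
    have htrace : τ.trace = (τ.trace.re : ℂ) := Complex.ext rfl (by simp [← him])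
    have hpos : 0 < τ.trace.re := h0.lt_of_ne fun h => hne <| hτ.trace_eq_zero_iff.mp <| by
      rw [htrace, ← h, Complex.ofReal_zero]
    refine sInf_le ⟨(τ.trace.re)⁻¹ • τ, ⟨hτ.smul (inv_nonneg.mpr h0), ?_⟩,
      (pDist_smul_le hτ hρ ((one_le_inv₀ hpos).mpr htr)).trans hd,
      (ImaxD_smul τ (inv_pos.mpr hpos)).symm⟩
    rw [trace_smul, Complex.real_smul, htrace, Complex.ofReal_re, ← Complex.ofReal_mul,
      inv_mul_cancel₀ hpos.ne', Complex.ofReal_one]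

end QITLeak
end
end
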